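/- Assume Hypothesis 3.1. Let u ∈ D(V) and let ν be a finite nonnegative Borel measure on [0,T] × H. Then there exist a sequence (u_n) ⊂ E_A([0,T]×H) and a constant c₁ > 0 such that |u_n(t,x)| + |V₀u_n(t,x)| ≤ c₁(1 + |x|²) for all (t,x) ∈ [0,T] × H, and u_n → u and V₀u_n → Vu in ν-measure as n → ∞. -/

import Mathlib

open MeasureTheory Set Filter Topology
open scoped InnerProductSpace ENNReal NNReal

attribute [local instance] Classical.propDecidable

noncomputable section

variable (H : Type) [NormedAddCommGroup H] [InnerProductSpace ℝ H] [CompleteSpace H]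
  [SecondCountableTopology H] [MeasurableSpace H] [BorelSpace H]

/-- All data of the framework: the `C₀`-semigroup `e^{tA}` with its generator `A`
(a densely defined unbounded operator), the diffusion operator `C` (symmetric, nonnegative)
with a square root `C^{1/2}`, a Hilbert basis of `H`, the time horizon `T > 0`, and the
Borel measurable drift `F` defined on a Borel set `DF ⊆ [0,T] × H`. -/
structure FPData where
  T : ℝ
  hT : 0 < T
  S : ℝ → H →L[ℝ] H
  S_zero : S 0 = 1
  S_add : ∀ s t : ℝ, 0 ≤ s → 0 ≤ t → S (s + t) = (S s).comp (S t)
  S_cont : ∀ x : H, ContinuousOn (fun t => S t x) (Ici (0 : ℝ))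
  A : H →ₗ.[ℝ] H
  A_dense : Dense (A.domain : Set H)
  A_mem_iff : ∀ x : H, x ∈ A.domain ↔
    ∃ y : H, Tendsto (fun t : ℝ => t⁻¹ • (S t x - x)) (𝓝[>] 0) (𝓝 y)
  A_gen : ∀ x : A.domain,
    Tendsto (fun t : ℝ => t⁻¹ • (S t (x : H) - (x : H))) (𝓝[>] 0) (𝓝 (A x))
  C : H →L[ℝ] H
  C_pos : C.IsPositive
  sqrtC : H →L[ℝ] H
  sqrtC_pos : sqrtC.IsPositive
  sqrtC_sq : sqrtC.comp sqrtC = C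
  ι : Type
  basis : HilbertBasis ι ℝ H
  F : ℝ × H → H
  DF : Set (ℝ × H)
  DF_meas : MeasurableSet DF
  F_meas : Measurable F

variable {H}

/-- The spatial gradient `D_x u(t,x)` of a function `u : ℝ × H → ℝ`. -/
def xGrad (u : ℝ × H → ℝ) (p : ℝ × H) : H :=
  gradient (fun z => u (p.1, z)) p.2

/-- The set `Sf` of functions is dense in `L¹([s,T] × H, μ)`. -/
def DenseRangeL1 (μ : Measure (ℝ × H)) (Sf : Set (ℝ × H → ℝ)) : Prop :=
  ∀ f : ℝ × H → ℝ, Integrable f μ → ∀ ε > 0,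
    ∃ g ∈ Sf, Integrable g μ ∧ ∫ p, |f p - g p| ∂μ < ε

namespace FPData

variable (D : FPData H)

/-- `h ∈ C¹([0,T]; D(A*))`, represented by the pair `(h, g)` with `g t = A* (h t)`. -/
def CinDAstar (h g : ℝ → H) : Prop :=
  ContDiffOn ℝ 1 h (Icc 0 D.T) ∧ ContDiffOn ℝ 1 g (Icc 0 D.T) ∧
    ∀ t ∈ Icc 0 D.T, (h t, g t) ∈ D.A.adjoint.graph

/-- Generators of `E_A([0,T] × H)`: real parts of `φ(t) e^{i⟨x, h(t)⟩}`. -/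
def EAgen : Set (ℝ × H → ℝ) :=
  {u | ∃ (φ : ℝ → ℝ) (h g : ℝ → H), ContDiffOn ℝ 1 φ (Icc 0 D.T) ∧ φ D.T = 0 ∧
    D.CinDAstar h g ∧
    (u = (fun p => φ p.1 * Real.cos ⟪p.2, h p.1⟫_ℝ) ∨
     u = (fun p => φ p.1 * Real.sin ⟪p.2, h p.1⟫_ℝ))}

/-- The space of test functions `E_A([0,T] × H) = D(L₀)`: the linear span of the generators. -/
def EA : Set (ℝ × H → ℝ) := ↑(Submodule.span ℝ D.EAgen)

/-- The trace term `Tr[C D²_x u(t,x)] = Σ_i ⟨D²_x u(t,x)(C^{1/2} e_i), C^{1/2} e_i⟩`. -/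
def traceCD2 (u : ℝ × H → ℝ) (p : ℝ × H) : ℝ :=
  ∑' i : D.ι,
    ⟪(fderiv ℝ (gradient fun z => u (p.1, z)) p.2) (D.sqrtC (D.basis i)),
      D.sqrtC (D.basis i)⟫_ℝ

/-- The Ornstein–Uhlenbeck part `V₀u = D_t u + (1/2)Tr[C D²_x u] + ⟨x, A* D_x u⟩`
of the Kolmogorov operator. -/
def Vzero (u : ℝ × H → ℝ) (p : ℝ × H) : ℝ :=
  deriv (fun r => u (r, p.2)) p.1 + (1 / 2) * D.traceCD2 u p +
    (if hk : xGrad u p ∈ D.A.adjoint.domain then ⟪p.2, D.A.adjoint ⟨xGrad u p, hk⟩⟫_ℝ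
     else 0)

/-- The Kolmogorov operator `L₀u = V₀u + ⟨F(t,x), D_x u⟩`. -/
def Lzero (u : ℝ × H → ℝ) (p : ℝ × H) : ℝ :=
  D.Vzero u p + ⟪D.F p, xGrad u p⟫_ℝ

/-- `|F(t,x)|`, with the convention `|F(t,x)| = +∞` outside `D(F)`. -/
def FnormE (p : ℝ × H) : ℝ≥0∞ := if p ∈ D.DF then (‖D.F p‖₊ : ℝ≥0∞) else ⊤

/-- Condition (1.6): `∫ (|⟨y, A*h(t)⟩| + |F(t,y)|) dμ < ∞` for all `h ∈ C¹([0,T]; D(A*))`. -/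
def DriftIntegrable (μ : Measure (ℝ × H)) : Prop :=
  ∀ h g : ℝ → H, D.CinDAstar h g →
    ∫⁻ p, ((‖⟪p.2, g p.1⟫_ℝ‖₊ : ℝ≥0∞) + D.FnormE p) ∂μ < ⊤

/-- `μ(dt,dx) = μ_t(dx) dt` on `[s,T] × H` for a measurable kernel `(μ_t)`. -/
def IsKernel (s : ℝ) (μ : Measure (ℝ × H)) (μt : ℝ → Measure H) : Prop :=
  (∀ B : Set H, MeasurableSet B → Measurable fun t => μt t B) ∧
  ∀ E : Set (ℝ × H), MeasurableSet E → μ E = ∫⁻ t in Icc s D.T, μt t {x | (t, x) ∈ E}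

/-- `μ = μ_t dt` is a solution of the Fokker–Planck equation (1.5) with initial condition
`ζ` at time `s` (membership in `M_{s,ζ}`). -/
def IsFPSol (s : ℝ) (ζ : Measure H) (μ : Measure (ℝ × H)) (μt : ℝ → Measure H) : Prop :=
  (∀ t ∈ Icc s D.T, IsProbabilityMeasure (μt t)) ∧
  D.IsKernel s μ μt ∧ D.DriftIntegrable μ ∧
  ∀ u ∈ D.EA, ∀ᵐ t ∂(volume.restrict (Icc s D.T)),
    ∫ y, u (t, y) ∂(μt t) =
      ∫ y, u (s, y) ∂ζ + ∫ r in Icc s t, (∫ y, D.Lzero u (r, y) ∂(μt r))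

/-- The set `M_{s,ζ}` of solutions of the Fokker–Planck equation. -/
def Mset (s : ℝ) (ζ : Measure H) : Set (Measure (ℝ × H)) :=
  {μ | ∃ μt : ℝ → Measure H, D.IsFPSol s ζ μ μt}

/-- Membership in `M_s^λ` (formula (4.2)): `ν = ν_t dt` is a finite nonnegative measure with
`∫ L₀ u dν ≤ 2λ ∫ u dν` for all nonnegative `u ∈ E_A`. -/
def IsSubInv (lam s : ℝ) (ν : Measure (ℝ × H)) (νt : ℝ → Measure H) : Prop :=
  (∀ t ∈ Icc s D.T, IsFiniteMeasure (νt t)) ∧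
  D.IsKernel s ν νt ∧ D.DriftIntegrable ν ∧
  ∀ u ∈ D.EA, (∀ p : ℝ × H, p.1 ∈ Icc 0 D.T → 0 ≤ u p) →
    ∫ t in Icc s D.T, (∫ y, D.Lzero u (t, y) ∂(νt t)) ≤
      2 * lam * ∫ t in Icc s D.T, (∫ y, u (t, y) ∂(νt t))

/-- The moment condition `∫_s^T ∫_H (|x|⁴ + |F(t,x)|² + |x|⁴|F(t,x)|²) ν_t(dx) dt < ∞`. -/
def moment2 (s : ℝ) (νt : ℝ → Measure H) : Prop :=
  ∫⁻ t in Icc s D.T, (∫⁻ y, (ENNReal.ofReal (‖y‖ ^ 4) + (D.FnormE (t, y)) ^ 2 +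
    ENNReal.ofReal (‖y‖ ^ 4) * (D.FnormE (t, y)) ^ 2) ∂(νt t)) < ⊤

/-- The moment condition `∫_s^T ∫_H (|x|² + |F(t,x)| + |x|²|F(t,x)|) ν_t(dx) dt < ∞`. -/
def moment1 (s : ℝ) (νt : ℝ → Measure H) : Prop :=
  ∫⁻ t in Icc s D.T, (∫⁻ y, (ENNReal.ofReal (‖y‖ ^ 2) + D.FnormE (t, y) +
    ENNReal.ofReal (‖y‖ ^ 2) * D.FnormE (t, y)) ∂(νt t)) < ⊤

/-- Hypothesis 3.1: dissipativity of `A`, trace class `Q_t = ∫_0^t e^{sA} C e^{sA*} ds`,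
and the smoothing condition `e^{tA}(H) ⊆ Q_t^{1/2}(H)` with `Λ_t := (Q_t^{1/2})^{-1} e^{tA}`
satisfying `∫_0^∞ e^{-λt} ‖Λ_t‖ dt < ∞` for `λ` large enough. -/
structure Hyp31 where
  ω : ℝ
  A_diss : ∀ x : D.A.domain, ⟪D.A x, (x : H)⟫_ℝ ≤ ω * ‖(x : H)‖ ^ 2
  Q : ℝ → H →L[ℝ] H
  Q_def : ∀ t : ℝ, 0 < t → ∀ x : H,
    Q t x = ∫ r in (0 : ℝ)..t, D.S r (D.C ((ContinuousLinearMap.adjoint (D.S r)) x))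
  Q_pos : ∀ t : ℝ, 0 < t → (Q t).IsPositive
  Q_traceClass : ∀ t : ℝ, 0 < t → Summable fun i : D.ι => ⟪Q t (D.basis i), D.basis i⟫_ℝ
  sqrtQ : ℝ → H →L[ℝ] H
  sqrtQ_pos : ∀ t : ℝ, 0 < t → (sqrtQ t).IsPositive
  sqrtQ_sq : ∀ t : ℝ, 0 < t → (sqrtQ t).comp (sqrtQ t) = Q t
  range_incl : ∀ t : ℝ, 0 < t → Set.range (D.S t) ⊆ Set.range (sqrtQ t)
  Λ : ℝ → H →L[ℝ] H
  Λ_spec : ∀ t : ℝ, 0 < t → (sqrtQ t).comp (Λ t) = D.S t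
  lam₀ : ℝ
  Λ_int : ∀ lam : ℝ, lam₀ ≤ lam →
    IntegrableOn (fun t => Real.exp (-lam * t) * ‖Λ t‖) (Ioi 0)

/-- Hypothesis 5.1: `F(t,·)` is the minimal section of an `m`-dissipative graph
`F̄(t,·)`, with `F(t,0) = 0`. -/
structure Hyp51 where
  Fbar : ℝ → H → Set H
  dom_meas : ∀ t ∈ Icc 0 D.T, MeasurableSet {x : H | (Fbar t x).Nonempty}
  K : ℝ
  K_pos : 0 < K
  diss : ∀ t ∈ Icc 0 D.T, ∀ x y u v : H, u ∈ Fbar t x → v ∈ Fbar t y →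
    ⟪u - v, x - y⟫_ℝ ≤ K * ‖x - y‖ ^ 2
  mrange : ∀ t ∈ Icc 0 D.T, ∀ lam : ℝ, K < lam → ∀ z : H,
    ∃ x : H, ∃ w ∈ Fbar t x, lam • x - w = z
  dom_eq : ∀ t ∈ Icc 0 D.T, ∀ x : H, (t, x) ∈ D.DF ↔ (Fbar t x).Nonempty
  minimal : ∀ t ∈ Icc 0 D.T, ∀ x : H, (t, x) ∈ D.DF →
    D.F (t, x) ∈ Fbar t x ∧ ∀ w ∈ Fbar t x, ‖D.F (t, x)‖ ≤ ‖w‖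
  zero_mem : ∀ t ∈ Icc 0 D.T, (t, (0 : H)) ∈ D.DF ∧ D.F (t, 0) = 0

/-- Hypothesis 3.3 for a drift `F₀ : [0,T] × H → H`: continuity, continuous space
derivative, and uniform Lipschitz continuity in the space variable. -/
def Hyp33 (F0 : ℝ × H → H) : Prop :=
  ContinuousOn F0 (Icc 0 D.T ×ˢ (univ : Set H)) ∧
  (∀ t ∈ Icc 0 D.T, ∀ x : H, DifferentiableAt ℝ (fun y => F0 (t, y)) x) ∧
  (∀ t ∈ Icc 0 D.T, Continuous fun x : H => fderiv ℝ (fun y => F0 (t, y)) x) ∧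
  ∃ K > 0, ∀ t ∈ Icc 0 D.T, ∀ x y : H, ‖F0 (t, x) - F0 (t, y)‖ ≤ K * ‖x - y‖

/-- The data of the Ornstein–Uhlenbeck semigroup: the Gaussian measures `N_{Q_t}`
(specified through their characteristic functionals). -/
structure OUData (hyp : D.Hyp31) where
  N : ℝ → Measure H
  N_prob : ∀ t : ℝ, 0 ≤ t → IsProbabilityMeasure (N t)
  N_zero : N 0 = Measure.dirac 0
  N_char : ∀ t : ℝ, 0 < t → ∀ h : H,
    ∫ x, Complex.exp ((⟪x, h⟫_ℝ : ℂ) * Complex.I) ∂(N t) =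
      Complex.exp (-((⟪hyp.Q t h, h⟫_ℝ : ℂ)) / 2)

end FPData

namespace FPData.OUData

variable {H : Type} [NormedAddCommGroup H] [InnerProductSpace ℝ H] [CompleteSpace H]
  [SecondCountableTopology H] [MeasurableSpace H] [BorelSpace H]
  {D : FPData H} {hyp : D.Hyp31}

/-- The Ornstein–Uhlenbeck semigroup `R_t φ(x) = ∫_H φ(e^{tA} x + y) N_{Q_t}(dy)`. -/
def Rop (O : D.OUData hyp) (t : ℝ) (φ : H → ℝ) (x : H) : ℝ :=
  ∫ y, φ (D.S t x + y) ∂(O.N t)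

/-- The resolvent `G̃_λ f(x) = ∫_0^∞ e^{-λt} R_t f(x) dt` of the OU semigroup. -/
def Gtilde (O : D.OUData hyp) (lam : ℝ) (f : H → ℝ) (x : H) : ℝ :=
  ∫ t in Ioi (0 : ℝ), Real.exp (-lam * t) * O.Rop t f x

/-- The resolvent `G_λ f(t,x) = ∫_t^T e^{-λ(r-t)} R_{r-t} f(r,·)(x) dr` of the
time-dependent OU operator `V`; by definition `u ∈ D(V)` iff `u = G_λ f` for some `λ` and
some `f ∈ C([0,T]; C_{u,2}(H))`, and then `Vu = λu - f`. -/
def Gop (O : D.OUData hyp) (lam : ℝ) (f : ℝ → H → ℝ) (p : ℝ × H) : ℝ :=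
  ∫ r in p.1..D.T, Real.exp (-lam * (r - p.1)) * O.Rop (r - p.1) (f r) p.2

end FPData.OUData

section Spaces

variable {H : Type} [NormedAddCommGroup H] [InnerProductSpace ℝ H] [CompleteSpace H]

/-- Membership in `C_{u,2}(H)`: `x ↦ φ(x)/(1+|x|²)` is uniformly continuous and bounded. -/
def MemCu2 (φ : H → ℝ) : Prop :=
  UniformContinuous (fun x : H => φ x / (1 + ‖x‖ ^ 2)) ∧
    ∃ M : ℝ, ∀ x : H, |φ x| ≤ M * (1 + ‖x‖ ^ 2)

/-- The norm of `C_{u,2}(H)`: `‖φ‖ = sup_x |φ(x)|/(1+|x|²)`. -/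
def cu2Norm (φ : H → ℝ) : ℝ := ⨆ x : H, |φ x| / (1 + ‖x‖ ^ 2)

/-- The sup norm `‖f‖_∞ = sup_x |f(x)|`. -/
def supNorm (f : H → ℝ) : ℝ := ⨆ x : H, |f x|

/-- Membership in `C¹_u(H)`: bounded and uniformly continuous together with the
(Fréchet) derivative. -/
def MemC1u (φ : H → ℝ) : Prop :=
  UniformContinuous φ ∧ (∃ M : ℝ, ∀ x : H, |φ x| ≤ M) ∧ Differentiable ℝ φ ∧
    UniformContinuous (gradient φ) ∧ ∃ M : ℝ, ∀ x : H, ‖gradient φ x‖ ≤ M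

/-- Membership in `C_u(H,H)`: bounded and uniformly continuous `H → H`. -/
def MemCuHH (Φ : H → H) : Prop := UniformContinuous Φ ∧ ∃ M : ℝ, ∀ x : H, ‖Φ x‖ ≤ M

end Spaces

namespace FPData

variable {H : Type} [NormedAddCommGroup H] [InnerProductSpace ℝ H] [CompleteSpace H]
  [SecondCountableTopology H] [MeasurableSpace H] [BorelSpace H] (D : FPData H)

/-- Membership in `C([0,T]; C_{u,2}(H))`. -/
def MemCT (f : ℝ → H → ℝ) : Prop :=
  (∀ t ∈ Icc 0 D.T, MemCu2 (f t)) ∧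
  ∀ t₀ ∈ Icc 0 D.T, ∀ ε > 0, ∃ δ > 0, ∀ t ∈ Icc 0 D.T, |t - t₀| < δ →
    ∀ x : H, |f t x - f t₀ x| ≤ ε * (1 + ‖x‖ ^ 2)

/-- Membership in `C([0,T]; C¹_u(H))`. -/
def MemCTC1u (f : ℝ → H → ℝ) : Prop :=
  (∀ t ∈ Icc 0 D.T, MemC1u (f t)) ∧
  ∀ t₀ ∈ Icc 0 D.T, ∀ ε > 0, ∃ δ > 0, ∀ t ∈ Icc 0 D.T, |t - t₀| < δ →
    ∀ x : H, |f t x - f t₀ x| + ‖gradient (f t) x - gradient (f t₀) x‖ ≤ ε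

/-- `D_x u ∈ C([0,T]; C_u(H,H))`. -/
def GradInCTCuHH (u : ℝ × H → ℝ) : Prop :=
  (∀ t ∈ Icc 0 D.T, MemCuHH fun x : H => xGrad u (t, x)) ∧
  ∀ t₀ ∈ Icc 0 D.T, ∀ ε > 0, ∃ δ > 0, ∀ t ∈ Icc 0 D.T, |t - t₀| < δ →
    ∀ x : H, ‖xGrad u (t, x) - xGrad u (t₀, x)‖ ≤ ε

end FPData

end

section Theorems

open MeasureTheory Set Filter Topology
open scoped InnerProductSpace ENNReal NNReal

variable {H : Type} [NormedAddCommGroup H] [InnerProductSpace ℝ H] [CompleteSpace H]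
  [SecondCountableTopology H] [MeasurableSpace H] [BorelSpace H]

set_option linter.unusedSectionVars false

namespace FPData

/-- Integrated form of `A* h = g`: the orbit `s ↦ ⟨e^{sA} x, h⟩` is a primitive of
`s ↦ ⟨e^{sA} x, g⟩` for every `x`. -/
def IsAdjPair (D : FPData H) (h g : H) : Prop :=
  ∀ x : H, ∀ s : ℝ, 0 ≤ s → ⟪D.S s x, h⟫_ℝ - ⟪x, h⟫_ℝ = ∫ r in (0 : ℝ)..s, ⟪D.S r x, g⟫_ℝ

/-- `A* h = g`, and the orbits of `h` and `g` under the adjoint semigroup are Lipschitz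
on `[0,T]`. -/
structure IsRegularPair (D : FPData H) (h g : H) : Prop where
  pair : D.IsAdjPair h g
  lip : ∃ K : ℝ, 0 ≤ K ∧ ∀ s ∈ Icc 0 D.T, ∀ t ∈ Icc 0 D.T,
    ‖ContinuousLinearMap.adjoint (D.S s) h - ContinuousLinearMap.adjoint (D.S t) h‖
      ≤ K * |s - t| ∧
    ‖ContinuousLinearMap.adjoint (D.S s) g - ContinuousLinearMap.adjoint (D.S t) g‖
      ≤ K * |s - t|

theorem exists_norm_S_le (D : FPData H) : ∃ M : ℝ, 1 ≤ M ∧ ∀ s ∈ Icc 0 D.T, ‖D.S s‖ ≤ M := by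
  have h : ∀ x : H, ∃ C, ∀ i : Icc (0 : ℝ) D.T, ‖D.S i x‖ ≤ C := by
    intro x
    have hc : ContinuousOn (fun t => D.S t x) (Icc 0 D.T) :=
      (D.S_cont x).mono Icc_subset_Ici_self
    obtain ⟨C, hC⟩ := isCompact_Icc.exists_bound_of_continuousOn hc
    exact ⟨C, fun i => hC i i.2⟩
  obtain ⟨M, hM⟩ := banach_steinhaus (g := fun i : Icc (0 : ℝ) D.T => D.S i) h
  exact ⟨max M 1, le_max_right _ _, fun s hs => (hM ⟨s, hs⟩).trans (le_max_left _ _)⟩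

theorem norm_S_apply_le {D : FPData H} {M : ℝ} (hM : ∀ s ∈ Icc 0 D.T, ‖D.S s‖ ≤ M)
    {s : ℝ} (hs : s ∈ Icc 0 D.T) (x : H) : ‖D.S s x‖ ≤ M * ‖x‖ :=
  (D.S s).le_of_opNorm_le (hM s hs) x

theorem S_comm (D : FPData H) {s t : ℝ} (hs : 0 ≤ s) (ht : 0 ≤ t) (x : H) :
    D.S s (D.S t x) = D.S t (D.S s x) := by
  have h1 := D.S_add s t hs ht
  have h2 := D.S_add t s ht hs
  rw [add_comm t s, h1] at h2
  exact DFunLike.congr_fun h2 x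

theorem intervalIntegrable_S (D : FPData H) (x : H) {a b : ℝ} (ha : 0 ≤ a) (hb : 0 ≤ b) :
    IntervalIntegrable (fun r => D.S r x) volume a b :=
  ((D.S_cont x).mono (by
    intro r hr
    exact (le_min ha hb).trans hr.1)).intervalIntegrable

theorem intervalIntegrable_inner_S (D : FPData H) (x g : H) {a b : ℝ} (ha : 0 ≤ a)
    (hb : 0 ≤ b) : IntervalIntegrable (fun r => ⟪D.S r x, g⟫_ℝ) volume a b :=
  (((D.S_cont x).inner continuousOn_const).mono (by
    intro r hr
    exact (le_min ha hb).trans hr.1)).intervalIntegrable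

/-- Cesàro averages `ε⁻¹ ∫_0^ε e^{rA} dr` of the semigroup are bounded operators. -/
theorem exists_average (D : FPData H) {M : ℝ} (hM : ∀ s ∈ Icc 0 D.T, ‖D.S s‖ ≤ M) {ε : ℝ}
    (hε : 0 < ε) (hT : ε ≤ D.T) :
    ∃ J : H →L[ℝ] H, ‖J‖ ≤ M ∧ ∀ x, J x = ε⁻¹ • ∫ r in (0 : ℝ)..ε, D.S r x := by
  have hM0 : 0 ≤ M := (norm_nonneg _).trans (hM 0 ⟨le_rfl, D.hT.le⟩)
  let L : H →ₗ[ℝ] H :=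
    { toFun := fun x => ε⁻¹ • ∫ r in (0 : ℝ)..ε, D.S r x
      map_add' := fun x y => by
        simp only [map_add]
        rw [intervalIntegral.integral_add (D.intervalIntegrable_S x le_rfl hε.le)
          (D.intervalIntegrable_S y le_rfl hε.le), smul_add]
      map_smul' := fun c x => by
        simp only [map_smul, RingHom.id_apply]
        rw [intervalIntegral.integral_smul, smul_comm] }
  have hL : ∀ x, ‖L x‖ ≤ M * ‖x‖ := by
    intro x
    have h1 : ‖∫ r in (0 : ℝ)..ε, D.S r x‖ ≤ M * ‖x‖ * |ε - 0| := by
      refine intervalIntegral.norm_integral_le_of_norm_le_const fun r hr => ?_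
      rw [uIoc_of_le hε.le] at hr
      exact norm_S_apply_le hM ⟨hr.1.le, hr.2.trans hT⟩ x
    rw [sub_zero, abs_of_pos hε] at h1
    change ‖ε⁻¹ • ∫ r in (0 : ℝ)..ε, D.S r x‖ ≤ _
    rw [norm_smul, norm_inv, Real.norm_of_nonneg hε.le]
    calc ε⁻¹ * ‖∫ r in (0 : ℝ)..ε, D.S r x‖ ≤ ε⁻¹ * (M * ‖x‖ * ε) := by gcongr
      _ = M * ‖x‖ := by field_simp
  exact ⟨L.mkContinuous M hL, L.mkContinuous_norm_le hM0 hL, fun x => rfl⟩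

theorem tendsto_average (D : FPData H) (x : H) {ε : ℕ → ℝ} (hε : ∀ n, 0 < ε n)
    (h0 : Tendsto ε atTop (𝓝 0)) :
    Tendsto (fun n => (ε n)⁻¹ • ∫ r in (0 : ℝ)..(ε n), D.S r x) atTop (𝓝 x) := by
  have h1 : HasDerivWithinAt (fun u => ∫ r in (0 : ℝ)..u, D.S r x) (D.S 0 x) (Ici 0) 0 := by
    refine intervalIntegral.integral_hasDerivWithinAt_right (t := Ioi 0) (by simp) ?_
      (((D.S_cont x) 0 self_mem_Ici).mono Ioi_subset_Ici_self)
    exact ⟨Ioi 0, self_mem_nhdsWithin,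
      ((D.S_cont x).mono Ioi_subset_Ici_self).aestronglyMeasurable measurableSet_Ioi⟩
  have h2 := (hasDerivWithinAt_iff_tendsto_slope.1 h1)
  have h3 : Tendsto ε atTop (𝓝[Ici 0 \ {0}] 0) := by
    refine tendsto_nhdsWithin_iff.2 ⟨h0, Eventually.of_forall fun n => ⟨(hε n).le, ?_⟩⟩
    exact (hε n).ne'
  have h4 := h2.comp h3
  simp only [D.S_zero, one_apply_eq_self] at h4
  refine h4.congr fun n => ?_
  simp [slope_def_module]

theorem isAdjPair_average (D : FPData H) {ε : ℝ} (hε : 0 < ε) {J : H →L[ℝ] H}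
    (hJ : ∀ x, J x = ε⁻¹ • ∫ r in (0 : ℝ)..ε, D.S r x) (y : H) :
    D.IsAdjPair (ContinuousLinearMap.adjoint J y)
      (ε⁻¹ • (ContinuousLinearMap.adjoint (D.S ε) y - y)) := by
  intro x s hs
  have hshift : ∫ r in (0 : ℝ)..ε, D.S r (D.S s x) = ∫ r in s..(s + ε), D.S r x := by
    have := intervalIntegral.integral_comp_add_left (a := 0) (b := ε) (fun r => D.S r x) s
    rw [add_zero] at this
    rw [← this]
    refine intervalIntegral.integral_congr fun r hr => ?_
    rw [uIcc_of_le hε.le] at hr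
    rw [add_comm s r, D.S_add r s hr.1 hs]
    rfl
  have hshift2 : ∫ r in (0 : ℝ)..s, D.S ε (D.S r x) = ∫ r in ε..(s + ε), D.S r x := by
    have := intervalIntegral.integral_comp_add_right (a := 0) (b := s) (fun r => D.S r x) ε
    rw [zero_add] at this
    rw [← this]
    refine intervalIntegral.integral_congr fun r hr => ?_
    rw [uIcc_of_le hs] at hr
    rw [add_comm r ε, D.S_add ε r hε.le hr.1]
    rfl
  have hse : 0 ≤ s + ε := by linarith
  have h_int : IntervalIntegrable (fun r => D.S ε (D.S r x)) volume 0 s := by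
    refine ContinuousOn.intervalIntegrable ?_
    refine (D.S ε).continuous.comp_continuousOn ((D.S_cont x).mono ?_)
    intro r hr
    rw [uIcc_of_le hs] at hr
    exact hr.1
  have key : J (D.S s x) - J x = ε⁻¹ • ∫ r in (0 : ℝ)..s, (D.S ε (D.S r x) - D.S r x) := by
    rw [intervalIntegral.integral_sub h_int (D.intervalIntegrable_S x le_rfl hs), hshift2, hJ, hJ,
      hshift, ← smul_sub]
    congr 1
    have e1 := intervalIntegral.integral_add_adjacent_intervals
      (D.intervalIntegrable_S x le_rfl hs) (D.intervalIntegrable_S x hs hse)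
    have e2 := intervalIntegral.integral_add_adjacent_intervals
      (D.intervalIntegrable_S x le_rfl hε.le) (D.intervalIntegrable_S x hε.le hse)
    rw [← e2] at e1
    rw [sub_eq_sub_iff_add_eq_add, add_comm, e1, add_comm]
  rw [ContinuousLinearMap.adjoint_inner_right, ContinuousLinearMap.adjoint_inner_right,
    ← inner_sub_left, key, real_inner_smul_left, real_inner_comm,
    ← innerSL_apply_apply ℝ y, ← ContinuousLinearMap.intervalIntegral_comp_comm _
      (h_int.sub (D.intervalIntegrable_S x le_rfl hs)), ← intervalIntegral.integral_const_mul]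
  refine intervalIntegral.integral_congr fun r _ => ?_
  simp only [innerSL_apply_apply, inner_smul_right, inner_sub_right,
    ContinuousLinearMap.adjoint_inner_right, real_inner_comm y]

theorem IsAdjPair.abs_sub_le {D : FPData H} {h g : H} (hp : D.IsAdjPair h g) {M : ℝ}
    (hM : ∀ s ∈ Icc 0 D.T, ‖D.S s‖ ≤ M) (x : H) {s t : ℝ} (hs : s ∈ Icc 0 D.T)
    (ht : t ∈ Icc 0 D.T) :
    |⟪D.S s x, h⟫_ℝ - ⟪D.S t x, h⟫_ℝ| ≤ M * ‖x‖ * ‖g‖ * |s - t| := by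
  have h1 := hp x s hs.1
  have h2 := hp x t ht.1
  have h3 := intervalIntegral.integral_interval_sub_left
    (D.intervalIntegrable_inner_S x g le_rfl hs.1) (D.intervalIntegrable_inner_S x g le_rfl ht.1)
  have h4 : ⟪D.S s x, h⟫_ℝ - ⟪D.S t x, h⟫_ℝ = ∫ r in t..s, ⟪D.S r x, g⟫_ℝ := by
    rw [← h3, ← h1, ← h2]; ring
  rw [h4, ← Real.norm_eq_abs]
  refine intervalIntegral.norm_integral_le_of_norm_le_const fun r hr => ?_
  have hr' : r ∈ Icc 0 D.T := by
    rw [mem_uIoc] at hr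
    rcases hr with hr | hr
    · exact ⟨ht.1.trans hr.1.le, hr.2.trans hs.2⟩
    · exact ⟨hs.1.trans hr.1.le, hr.2.trans ht.2⟩
  refine (norm_inner_le_norm _ _).trans ?_
  gcongr
  exact norm_S_apply_le hM hr' x

theorem norm_le_of_forall_abs_inner_le {v : H} {c : ℝ} (hc : 0 ≤ c)
    (h : ∀ x : H, |⟪x, v⟫_ℝ| ≤ c * ‖x‖) : ‖v‖ ≤ c := by
  rcases eq_or_ne v 0 with rfl | hv
  · simpa using hc
  have := h v
  rw [real_inner_self_eq_norm_sq, abs_of_nonneg (by positivity), sq] at this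
  exact le_of_mul_le_mul_right this (norm_pos_iff.2 hv)

theorem IsAdjPair.norm_adjoint_sub_le {D : FPData H} {h g : H} (hp : D.IsAdjPair h g) {M : ℝ}
    (hM0 : 0 ≤ M) (hM : ∀ s ∈ Icc 0 D.T, ‖D.S s‖ ≤ M) {s t : ℝ} (hs : s ∈ Icc 0 D.T)
    (ht : t ∈ Icc 0 D.T) :
    ‖ContinuousLinearMap.adjoint (D.S s) h - ContinuousLinearMap.adjoint (D.S t) h‖
      ≤ M * ‖g‖ * |s - t| := by
  refine norm_le_of_forall_abs_inner_le (by positivity) fun x => ?_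
  rw [inner_sub_right, ContinuousLinearMap.adjoint_inner_right,
    ContinuousLinearMap.adjoint_inner_right]
  refine (hp.abs_sub_le hM x hs ht).trans_eq ?_
  ring

theorem IsAdjPair.mem_graph {D : FPData H} {h g : H} (hp : D.IsAdjPair h g) :
    (h, g) ∈ D.A.adjoint.graph := by
  rw [LinearPMap.adjoint_graph_eq_graph_adjoint D.A_dense, Submodule.mem_adjoint_iff]
  intro a b hab
  rw [LinearPMap.mem_graph_iff] at hab
  obtain ⟨y, rfl, rfl⟩ := hab
  have h1 : Tendsto (fun t : ℝ => ⟪t⁻¹ • (D.S t (y : H) - (y : H)), h⟫_ℝ) (𝓝[>] 0)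
      (𝓝 ⟪D.A y, h⟫_ℝ) := (D.A_gen y).inner tendsto_const_nhds
  have hc : ContinuousOn (fun t => ⟪D.S t (y : H), g⟫_ℝ) (Ici 0) :=
    (D.S_cont y).inner continuousOn_const
  have h2 : HasDerivWithinAt (fun u => ∫ r in (0 : ℝ)..u, ⟪D.S r (y : H), g⟫_ℝ)
      ⟪D.S 0 (y : H), g⟫_ℝ (Ici 0) 0 := by
    refine intervalIntegral.integral_hasDerivWithinAt_right (t := Ioi 0) (by simp) ?_
      ((hc 0 self_mem_Ici).mono Ioi_subset_Ici_self)
    exact ⟨Ioi 0, self_mem_nhdsWithin,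
      (hc.mono Ioi_subset_Ici_self).aestronglyMeasurable measurableSet_Ioi⟩
  have h3 := hasDerivWithinAt_iff_tendsto_slope.1 h2
  rw [Ici_sdiff_left] at h3
  simp only [D.S_zero, one_apply_eq_self] at h3
  have h4 : Tendsto (fun t : ℝ => ⟪t⁻¹ • (D.S t (y : H) - (y : H)), h⟫_ℝ) (𝓝[>] 0)
      (𝓝 ⟪(y : H), g⟫_ℝ) := by
    refine h3.congr' ?_
    filter_upwards [self_mem_nhdsWithin] with t ht
    have ht' : (0 : ℝ) ≤ t := le_of_lt ht
    rw [slope_def_module, real_inner_smul_left, inner_sub_left, hp _ t ht']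
    simp
  exact sub_eq_zero.2 (tendsto_nhds_unique h1 h4)

theorem IsAdjPair.adjoint_S {D : FPData H} {h g : H} (hp : D.IsAdjPair h g) {s : ℝ}
    (hs : 0 ≤ s) : D.IsAdjPair (ContinuousLinearMap.adjoint (D.S s) h)
      (ContinuousLinearMap.adjoint (D.S s) g) := by
  intro x r hr
  simp only [ContinuousLinearMap.adjoint_inner_right]
  rw [D.S_comm hs hr, hp (D.S s x) r hr]
  refine intervalIntegral.integral_congr fun ρ hρ => ?_
  rw [uIcc_of_le hr] at hρ
  rw [D.S_comm hρ.1 hs]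

theorem isRegularPair_average (D : FPData H) {ε : ℝ} (hε : 0 < ε) (hT : ε ≤ D.T) {J : H →L[ℝ] H}
    (hJ : ∀ x, J x = ε⁻¹ • ∫ r in (0 : ℝ)..ε, D.S r x) (y : H) :
    ∃ g, D.IsRegularPair (ContinuousLinearMap.adjoint (J.comp J) y) g := by
  obtain ⟨M, hM1, hM⟩ := D.exists_norm_S_le
  have hM0 : 0 ≤ M := by linarith
  set z := ContinuousLinearMap.adjoint J y with hz
  have hpz := D.isAdjPair_average hε hJ y
  rw [← hz] at hpz
  set g₀ := ε⁻¹ • (ContinuousLinearMap.adjoint (D.S ε) y - y)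
  have hph := D.isAdjPair_average hε hJ z
  set g := ε⁻¹ • (ContinuousLinearMap.adjoint (D.S ε) z - z) with hg
  have heq : ContinuousLinearMap.adjoint (J.comp J) y = ContinuousLinearMap.adjoint J z := by
    rw [ContinuousLinearMap.adjoint_comp]; rfl
  rw [heq]
  refine ⟨g, hph, max (M * ‖g‖) (ε⁻¹ * (M + 1) * (M * ‖g₀‖)), by positivity,
    fun s hs t ht => ⟨?_, ?_⟩⟩
  · refine (hph.norm_adjoint_sub_le hM0 hM hs ht).trans ?_
    gcongr
    exact le_max_left _ _
  · have hcomm : ∀ r, 0 ≤ r → ContinuousLinearMap.adjoint (D.S r) g =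
        ε⁻¹ • (ContinuousLinearMap.adjoint (D.S ε) (ContinuousLinearMap.adjoint (D.S r) z) -
          ContinuousLinearMap.adjoint (D.S r) z) := by
      intro r hr
      refine ext_inner_left ℝ fun x => ?_
      simp only [hg, inner_smul_right, inner_sub_right, map_smul, map_sub,
        ContinuousLinearMap.adjoint_inner_right]
      rw [D.S_comm hr hε.le]
    rw [hcomm s hs.1, hcomm t ht.1, ← smul_sub, norm_smul, norm_inv, Real.norm_of_nonneg hε.le]
    have h1 := hpz.norm_adjoint_sub_le hM0 hM hs ht
    set a := ContinuousLinearMap.adjoint (D.S s) z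
    set b := ContinuousLinearMap.adjoint (D.S t) z
    have h2 : ‖ContinuousLinearMap.adjoint (D.S ε) (a - b)‖ ≤ M * ‖a - b‖ :=
      ContinuousLinearMap.le_of_opNorm_le _
        (by rw [LinearIsometryEquiv.norm_map]; exact hM ε ⟨hε.le, hT⟩) _
    have h3 : ‖ContinuousLinearMap.adjoint (D.S ε) a - a -
        (ContinuousLinearMap.adjoint (D.S ε) b - b)‖ ≤ (M + 1) * ‖a - b‖ := by
      have : ContinuousLinearMap.adjoint (D.S ε) a - a -
          (ContinuousLinearMap.adjoint (D.S ε) b - b) =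
          ContinuousLinearMap.adjoint (D.S ε) (a - b) - (a - b) := by
        rw [map_sub]; abel
      rw [this]
      refine (norm_sub_le _ _).trans ?_
      linarith
    calc ε⁻¹ * _ ≤ ε⁻¹ * ((M + 1) * (M * ‖g₀‖ * |s - t|)) := by
          gcongr
          exact h3.trans (by gcongr)
      _ = ε⁻¹ * (M + 1) * (M * ‖g₀‖) * |s - t| := by ring
      _ ≤ _ := by gcongr; exact le_max_right _ _

/-- Uniformly bounded operators converging strongly to the identity whose adjoints map into
regular elements of `D(A*)`. -/
theorem exists_smoothing (D : FPData H) :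
    ∃ (J : ℕ → H →L[ℝ] H) (M : ℝ), (∀ n, ‖J n‖ ≤ M) ∧ (∀ x, Tendsto (fun n => J n x) atTop (𝓝 x)) ∧
      ∀ n y, ∃ g, D.IsRegularPair (ContinuousLinearMap.adjoint (J n) y) g := by
  obtain ⟨M, hM1, hM⟩ := D.exists_norm_S_le
  have hε : ∀ n : ℕ, 0 < D.T / ((n : ℝ) + 1) := fun n => div_pos D.hT (by positivity)
  have hεT : ∀ n : ℕ, D.T / ((n : ℝ) + 1) ≤ D.T := fun n =>
    div_le_self D.hT.le (by linarith [n.cast_nonneg (α := ℝ)])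
  choose J hJM hJ using fun n : ℕ => D.exists_average hM (hε n) (hεT n)
  have hlim : ∀ x, Tendsto (fun n => J n x) atTop (𝓝 x) := by
    intro x
    simp only [hJ]
    exact D.tendsto_average x hε (tendsto_const_nhds.div_atTop
      (tendsto_atTop_add_const_right _ _ tendsto_natCast_atTop_atTop))
  refine ⟨fun n => (J n).comp (J n), M * M, fun n => ?_, fun x => ?_, fun n y =>
    D.isRegularPair_average (hε n) (hεT n) (hJ n) y⟩
  · exact ((J n).opNorm_comp_le (J n)).trans
      (mul_le_mul (hJM n) (hJM n) (norm_nonneg _) (by linarith))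
  · have h1 : Tendsto (fun n => J n (J n x - x)) atTop (𝓝 0) := by
      refine squeeze_zero_norm (fun n => (J n).le_of_opNorm_le (hJM n) _) ?_
      have := ((hlim x).sub_const x).norm.const_mul M
      simpa using this
    have := h1.add (hlim x)
    simpa using this

end FPData

namespace FPData

/-- `v ∈ E_A` is a regular test function and `w = V₀ v` holds with all the derivatives
occurring in `V₀ v` existing in the strong sense. -/
def IsOUPair (D : FPData H) (v w : ℝ × H → ℝ) : Prop :=
  v ∈ D.EA ∧ Continuous v ∧ Continuous w ∧
    ∃ (dt tr : ℝ × H → ℝ) (G b : ℝ × H → H) (B : ℝ × H → H →L[ℝ] H), ∀ p : ℝ × H,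
      HasDerivAt (fun r => v (r, p.2)) (dt p) p.1 ∧
      HasGradientAt (fun z => v (p.1, z)) (G p) p.2 ∧
      HasFDerivAt (fun z => G (p.1, z)) (B p) p.2 ∧
      HasSum (fun i : D.ι => ⟪B p (D.sqrtC (D.basis i)), D.sqrtC (D.basis i)⟫_ℝ) (tr p) ∧
      (G p, b p) ∈ D.A.adjoint.graph ∧
      w p = dt p + (1 / 2) * tr p + ⟪p.2, b p⟫_ℝ

theorem IsOUPair.Vzero_eq {D : FPData H} {v w : ℝ × H → ℝ} (h : D.IsOUPair v w) :
    D.Vzero v = w := by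
  obtain ⟨-, -, -, dt, tr, G, b, B, hp⟩ := h
  funext p
  obtain ⟨h1, h2, h3, h4, h5, h6⟩ := hp p
  have hG : xGrad v p = G p := h2.gradient
  have hGf : (gradient fun z => v (p.1, z)) = fun z => G (p.1, z) := by
    funext z
    exact (hp (p.1, z)).2.1.gradient
  have htr : D.traceCD2 v p = tr p := by
    rw [traceCD2, hGf, h3.fderiv]
    exact h4.tsum_eq
  rw [LinearPMap.mem_graph_iff] at h5
  obtain ⟨y, hy1, hy2⟩ := h5
  have hmem : xGrad v p ∈ D.A.adjoint.domain := by
    have hy : (y : H) = G p := hy1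
    rw [hG, ← hy]
    exact y.2
  rw [Vzero, dif_pos hmem, h1.deriv, htr, h6]
  congr 2
  refine Eq.trans ?_ hy2
  congr 1
  exact Subtype.ext (hG.trans hy1.symm)

theorem isOUPair_zero (D : FPData H) : D.IsOUPair 0 0 := by
  refine ⟨Submodule.zero_mem _, continuous_zero, continuous_zero, 0, 0, 0, 0, 0, fun p =>
    ⟨?_, ?_, ?_, ?_, ?_, ?_⟩⟩
  · exact hasDerivAt_const _ _
  · exact hasGradientAt_const _ _
  · exact hasFDerivAt_const _ _
  · simp
  · exact Submodule.zero_mem _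
  · simp

theorem IsOUPair.add {D : FPData H} {v w v' w' : ℝ × H → ℝ} (h : D.IsOUPair v w)
    (h' : D.IsOUPair v' w') : D.IsOUPair (v + v') (w + w') := by
  obtain ⟨m, c, d, dt, tr, G, b, B, hp⟩ := h
  obtain ⟨m', c', d', dt', tr', G', b', B', hp'⟩ := h'
  refine ⟨Submodule.add_mem _ m m', c.add c', d.add d', dt + dt', tr + tr', G + G', b + b',
    B + B', fun p => ?_⟩
  obtain ⟨h1, h2, h3, h4, h5, h6⟩ := hp p
  obtain ⟨h1', h2', h3', h4', h5', h6'⟩ := hp' p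
  refine ⟨h1.add h1', ?_, h3.add h3', ?_, Submodule.add_mem _ h5 h5', ?_⟩
  · rw [hasGradientAt_iff_hasFDerivAt] at h2 h2' ⊢
    rw [Pi.add_apply, map_add]
    exact h2.add h2'
  · simpa [inner_add_left] using h4.add h4'
  · simp only [Pi.add_apply, h6, h6', inner_add_right]
    ring

theorem IsOUPair.smul {D : FPData H} {v w : ℝ × H → ℝ} (h : D.IsOUPair v w) (a : ℝ) :
    D.IsOUPair (a • v) (a • w) := by
  obtain ⟨m, c, d, dt, tr, G, b, B, hp⟩ := h
  refine ⟨Submodule.smul_mem _ a m, c.const_smul a, d.const_smul a, a • dt, a • tr, a • G,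
    a • b, a • B, fun p => ?_⟩
  obtain ⟨h1, h2, h3, h4, h5, h6⟩ := hp p
  refine ⟨h1.const_smul a, ?_, h3.const_smul a, ?_, Submodule.smul_mem _ a h5, ?_⟩
  · rw [hasGradientAt_iff_hasFDerivAt] at h2 ⊢
    rw [Pi.smul_apply, map_smul]
    exact h2.const_smul a
  · simpa [real_inner_smul_left] using h4.mul_left a
  · simp only [Pi.smul_apply, smul_eq_mul, h6, real_inner_smul_right]
    ring

theorem IsOUPair.sum {D : FPData H} {ι : Type*} (s : Finset ι) {v w : ι → ℝ × H → ℝ}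
    (h : ∀ i ∈ s, D.IsOUPair (v i) (w i)) : D.IsOUPair (∑ i ∈ s, v i) (∑ i ∈ s, w i) := by
  classical
  induction s using Finset.induction_on with
  | empty => simpa using D.isOUPair_zero
  | insert i s hi ih =>
    rw [Finset.sum_insert hi, Finset.sum_insert hi]
    exact (h i (Finset.mem_insert_self _ _)).add
      (ih fun j hj => h j (Finset.mem_insert_of_mem hj))

/-- `V₀` applied to the plane wave `φ(t) cos(⟨x,h⟩ + θ)`, where `g = A* h` and `φ' = φd`. -/
noncomputable def waveV (D : FPData H) (φ φd : ℝ → ℝ) (h g : H) (θ : ℝ) (p : ℝ × H) : ℝ :=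
  φd p.1 * Real.cos (⟪p.2, h⟫_ℝ + θ) -
    (1 / 2) * (φ p.1 * ⟪D.C h, h⟫_ℝ * Real.cos (⟪p.2, h⟫_ℝ + θ)) -
    φ p.1 * ⟪p.2, g⟫_ℝ * Real.sin (⟪p.2, h⟫_ℝ + θ)

theorem isOUPair_wave (D : FPData H) {φ φd : ℝ → ℝ} (hφ : ∀ t, HasDerivAt φ (φd t) t)
    (hφd : Continuous φd) (hT : φ D.T = 0) {h g : H} (hg : (h, g) ∈ D.A.adjoint.graph)
    (θ : ℝ) :
    D.IsOUPair (fun p => φ p.1 * Real.cos (⟪p.2, h⟫_ℝ + θ)) (D.waveV φ φd h g θ) := by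
  have hcφ : Continuous φ := continuous_iff_continuousAt.2 fun t => (hφ t).continuousAt
  have hφC : ContDiff ℝ 1 φ := by
    rw [contDiff_one_iff_deriv]
    refine ⟨fun t => (hφ t).differentiableAt, ?_⟩
    have : deriv φ = φd := funext fun t => (hφ t).deriv
    rwa [this]
  refine ⟨?_, by fun_prop, by unfold waveV; fun_prop,
    fun p => φd p.1 * Real.cos (⟪p.2, h⟫_ℝ + θ),
    fun p => -(φ p.1 * ⟪D.C h, h⟫_ℝ * Real.cos (⟪p.2, h⟫_ℝ + θ)),
    fun p => (-(φ p.1 * Real.sin (⟪p.2, h⟫_ℝ + θ))) • h,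
    fun p => (-(φ p.1 * Real.sin (⟪p.2, h⟫_ℝ + θ))) • g,
    fun p => ((-(φ p.1 * Real.cos (⟪p.2, h⟫_ℝ + θ))) • innerSL ℝ h).smulRight h,
    fun p => ⟨?_, ?_, ?_, ?_, Submodule.smul_mem _ _ hg, ?_⟩⟩
  · have hh : D.CinDAstar (fun _ => h) (fun _ => g) :=
      ⟨contDiffOn_const, contDiffOn_const, fun t _ => hg⟩
    have h1 : (fun p : ℝ × H => φ p.1 * Real.cos ⟪p.2, h⟫_ℝ) ∈ D.EAgen :=
      ⟨φ, _, _, hφC.contDiffOn, hT, hh, Or.inl rfl⟩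
    have h2 : (fun p : ℝ × H => φ p.1 * Real.sin ⟪p.2, h⟫_ℝ) ∈ D.EAgen :=
      ⟨φ, _, _, hφC.contDiffOn, hT, hh, Or.inr rfl⟩
    have h3 := Submodule.sub_mem _
      (Submodule.smul_mem _ (Real.cos θ) (Submodule.subset_span (R := ℝ) h1))
      (Submodule.smul_mem _ (Real.sin θ) (Submodule.subset_span (R := ℝ) h2))
    refine Set.mem_of_eq_of_mem ?_ h3
    funext p
    simp only [Real.cos_add, Pi.sub_apply, Pi.smul_apply, smul_eq_mul]
    ring
  · exact (hφ p.1).mul_const (Real.cos (⟪p.2, h⟫_ℝ + θ))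
  · rw [hasGradientAt_iff_hasFDerivAt]
    have h1 : HasFDerivAt (fun z : H => ⟪z, h⟫_ℝ + θ) (innerSL ℝ h) p.2 := by
      have := ((innerSL ℝ h).hasFDerivAt (x := p.2)).add_const θ
      refine this.congr_of_eventuallyEq (Eventually.of_forall fun z => ?_)
      simp [real_inner_comm]
    refine (h1.cos.const_mul (φ p.1)).congr_fderiv ?_
    ext y
    simp
    ring
  · have h1 : HasFDerivAt (fun z : H => ⟪z, h⟫_ℝ + θ) (innerSL ℝ h) p.2 := by
      have := ((innerSL ℝ h).hasFDerivAt (x := p.2)).add_const θ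
      refine this.congr_of_eventuallyEq (Eventually.of_forall fun z => ?_)
      simp [real_inner_comm]
    refine ((h1.sin.const_mul (φ p.1)).neg.smul_const h).congr_fderiv ?_
    ext y
    simp [smul_smul]
  · have h1 := D.basis.hasSum_inner_mul_inner (D.sqrtC h) (D.sqrtC h)
    have hsa : ∀ x y : H, ⟪D.sqrtC x, y⟫_ℝ = ⟪x, D.sqrtC y⟫_ℝ :=
      D.sqrtC_pos.isSymmetric
    have h2 : ⟪D.C h, h⟫_ℝ = ⟪D.sqrtC h, D.sqrtC h⟫_ℝ := by
      rw [← D.sqrtC_sq]; exact hsa _ _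
    have h3 := h1.mul_left (-(φ p.1 * Real.cos (⟪p.2, h⟫_ℝ + θ)))
    rw [← h2] at h3
    have e : -(φ p.1 * ⟪D.C h, h⟫_ℝ * Real.cos (⟪p.2, h⟫_ℝ + θ)) =
        -(φ p.1 * Real.cos (⟪p.2, h⟫_ℝ + θ)) * ⟪D.C h, h⟫_ℝ := by ring
    change HasSum _ (-(φ p.1 * ⟪D.C h, h⟫_ℝ * Real.cos (⟪p.2, h⟫_ℝ + θ)))
    rw [e]
    refine Eq.mp (congrArg (fun F => HasSum F _) (funext fun i => ?_)) h3
    simp only [ContinuousLinearMap.smulRight_apply, smul_apply,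
      innerSL_apply_apply, real_inner_smul_left, smul_eq_mul]
    rw [hsa, real_inner_comm (D.sqrtC h) (D.basis i), hsa]
    ring
  · simp only [waveV, real_inner_smul_right]
    ring

end FPData

namespace FPData

theorem IsRegularPair.continuousOn_fst {D : FPData H} {h g : H} (hp : D.IsRegularPair h g) :
    ContinuousOn (fun s => ContinuousLinearMap.adjoint (D.S s) h) (Icc 0 D.T) := by
  obtain ⟨K, hK, hl⟩ := hp.lip
  refine LipschitzOnWith.continuousOn (K := K.toNNReal) (LipschitzOnWith.of_dist_le_mul ?_)
  intro s hs t ht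
  rw [dist_eq_norm, Real.dist_eq, Real.coe_toNNReal K hK]
  exact (hl s hs t ht).1

theorem IsRegularPair.continuousOn_snd {D : FPData H} {h g : H} (hp : D.IsRegularPair h g) :
    ContinuousOn (fun s => ContinuousLinearMap.adjoint (D.S s) g) (Icc 0 D.T) := by
  obtain ⟨K, hK, hl⟩ := hp.lip
  refine LipschitzOnWith.continuousOn (K := K.toNNReal) (LipschitzOnWith.of_dist_le_mul ?_)
  intro s hs t ht
  rw [dist_eq_norm, Real.dist_eq, Real.coe_toNNReal K hK]
  exact (hl s hs t ht).2

theorem continuousOn_S_apply (D : FPData H) {z : ℝ → H} (hz : ContinuousOn z (Icc 0 D.T)) :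
    ContinuousOn (fun s => D.S s (z s)) (Icc 0 D.T) := by
  obtain ⟨M, -, hM⟩ := D.exists_norm_S_le
  intro s hs
  have h1 : Tendsto (fun r => D.S r (z r - z s)) (𝓝[Icc 0 D.T] s) (𝓝 0) := by
    refine squeeze_zero_norm' (a := fun r => M * ‖z r - z s‖) ?_ ?_
    · filter_upwards [self_mem_nhdsWithin] with r hr
      exact norm_S_apply_le hM hr _
    · have := ((hz s hs).sub_const (z s)).norm.const_mul M
      simpa using this
  have h2 : Tendsto (fun r => D.S r (z s)) (𝓝[Icc 0 D.T] s) (𝓝 (D.S s (z s))) :=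
    ((D.S_cont (z s)).mono Icc_subset_Ici_self) s hs
  have h3 := h1.add h2
  rw [zero_add] at h3
  refine h3.congr fun r => ?_
  simp

theorem IsRegularPair.inner_Q {D : FPData H} (hyp : D.Hyp31) {h g : H}
    (hp : D.IsRegularPair h g) {t : ℝ} (ht0 : 0 < t) (htT : t ≤ D.T) :
    ⟪hyp.Q t h, h⟫_ℝ = ∫ r in (0 : ℝ)..t, ⟪D.C (ContinuousLinearMap.adjoint (D.S r) h),
      ContinuousLinearMap.adjoint (D.S r) h⟫_ℝ := by
  have hc : ContinuousOn
      (fun r => D.S r (D.C (ContinuousLinearMap.adjoint (D.S r) h))) (Icc 0 D.T) :=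
    D.continuousOn_S_apply (D.C.continuous.comp_continuousOn hp.continuousOn_fst)
  have hi : IntervalIntegrable
      (fun r => D.S r (D.C (ContinuousLinearMap.adjoint (D.S r) h))) volume 0 t := by
    refine ContinuousOn.intervalIntegrable ?_
    rw [uIcc_of_le ht0.le]
    exact hc.mono (Icc_subset_Icc_right htT)
  rw [hyp.Q_def t ht0, real_inner_comm, ← innerSL_apply_apply (𝕜 := ℝ),
    ← ContinuousLinearMap.intervalIntegral_comp_comm _ hi]
  refine intervalIntegral.integral_congr fun r _ => ?_
  simp only [innerSL_apply_apply]
  rw [real_inner_comm, ContinuousLinearMap.adjoint_inner_right]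

theorem exists_dense_regular (D : FPData H) :
    Dense {h : H | ∃ g, D.IsRegularPair h g} := by
  let W : Submodule ℝ H :=
    { carrier := {h : H | ∃ g, D.IsRegularPair h g}
      zero_mem' := ⟨0, by
        intro x s hs; simp, 0, le_rfl, by simp⟩
      add_mem' := by
        rintro a b ⟨g, hg⟩ ⟨g', hg'⟩
        refine ⟨g + g', ?_, ?_⟩
        · intro x s hs
          have e1 := hg.pair x s hs
          have e2 := hg'.pair x s hs
          simp only [inner_add_right]
          rw [intervalIntegral.integral_add (D.intervalIntegrable_inner_S x g le_rfl hs)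
            (D.intervalIntegrable_inner_S x g' le_rfl hs)]
          linarith
        · obtain ⟨K, hK, hl⟩ := hg.lip
          obtain ⟨K', hK', hl'⟩ := hg'.lip
          refine ⟨K + K', by positivity, fun s hs t ht => ?_⟩
          have e1 := hl s hs t ht
          have e2 := hl' s hs t ht
          simp only [map_add, add_sub_add_comm]
          constructor <;> refine (norm_add_le _ _).trans ?_ <;> linarith [e1.1, e2.1, e1.2, e2.2]
      smul_mem' := by
        rintro c a ⟨g, hg⟩
        refine ⟨c • g, ?_, ?_⟩
        · intro x s hs
          have e1 := hg.pair x s hs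
          simp only [inner_smul_right]
          rw [intervalIntegral.integral_const_mul]
          rw [← e1]
          ring
        · obtain ⟨K, hK, hl⟩ := hg.lip
          refine ⟨|c| * K, by positivity, fun s hs t ht => ?_⟩
          have e1 := hl s hs t ht
          simp only [map_smul, ← smul_sub, norm_smul, Real.norm_eq_abs, mul_assoc]
          exact ⟨mul_le_mul_of_nonneg_left e1.1 (abs_nonneg _),
            mul_le_mul_of_nonneg_left e1.2 (abs_nonneg _)⟩ }
  have hW : (W : Set H) = {h : H | ∃ g, D.IsRegularPair h g} := rfl
  rw [← hW, Submodule.dense_iff_topologicalClosure_eq_top,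
    Submodule.topologicalClosure_eq_top_iff, Submodule.eq_bot_iff]
  intro x hx
  obtain ⟨J, -, -, hJ, hreg⟩ := D.exists_smoothing
  have hz : ∀ n, J n x = 0 := fun n => by
    refine ext_inner_right ℝ fun y => ?_
    rw [← ContinuousLinearMap.adjoint_inner_right, inner_zero_left, real_inner_comm]
    exact hx _ (hreg n y)
  have := hJ x
  simp only [hz] at this
  exact (tendsto_nhds_unique this tendsto_const_nhds)

theorem inner_Q_mono {D : FPData H} (hyp : D.Hyp31) {t : ℝ} (ht0 : 0 < t) (htT : t ≤ D.T)
    (h : H) : ⟪hyp.Q t h, h⟫_ℝ ≤ ⟪hyp.Q D.T h, h⟫_ℝ := by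
  have hcl : IsClosed {h : H | ⟪hyp.Q t h, h⟫_ℝ ≤ ⟪hyp.Q D.T h, h⟫_ℝ} :=
    isClosed_le (by fun_prop) (by fun_prop)
  have hsub : {h : H | ∃ g, D.IsRegularPair h g} ⊆
      {h : H | ⟪hyp.Q t h, h⟫_ℝ ≤ ⟪hyp.Q D.T h, h⟫_ℝ} := by
    rintro h ⟨g, hp⟩
    have hc : ContinuousOn (fun r => ⟪D.C (ContinuousLinearMap.adjoint (D.S r) h),
        ContinuousLinearMap.adjoint (D.S r) h⟫_ℝ) (Icc 0 D.T) :=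
      (D.C.continuous.comp_continuousOn hp.continuousOn_fst).inner hp.continuousOn_fst
    rw [mem_ofPred_eq, hp.inner_Q hyp ht0 htT, hp.inner_Q hyp D.hT le_rfl]
    refine intervalIntegral.integral_mono_interval le_rfl ht0.le htT
      (Eventually.of_forall fun r => ?_) ?_
    · exact D.C_pos.inner_nonneg_left _
    · refine ContinuousOn.intervalIntegrable ?_
      rwa [uIcc_of_le D.hT.le]
  have := D.exists_dense_regular.closure_eq ▸ closure_minimal hsub hcl
  exact this (mem_univ h)

end FPData

namespace FPData

theorem two_mul_sq_mul_one_sub_cos_le {c N : ℝ} (hN : 0 < N) :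
    2 * N ^ 2 * (1 - Real.cos (c / N)) ≤ c ^ 2 := by
  have h := Real.one_sub_sq_div_two_le_cos (x := c / N)
  calc 2 * N ^ 2 * (1 - Real.cos (c / N)) ≤ 2 * N ^ 2 * ((c / N) ^ 2 / 2) :=
        mul_le_mul_of_nonneg_left (by linarith) (by positivity)
    _ = c ^ 2 := by field_simp

theorem le_two_mul_sq_mul_one_sub_cos {c N : ℝ} (hN : 0 < N) :
    c ^ 2 * (1 - c ^ 2 / N ^ 2) ≤ 2 * N ^ 2 * (1 - Real.cos (c / N)) := by
  rw [← div_pow]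
  have hc : c ^ 2 = N ^ 2 * (c / N) ^ 2 := by field_simp
  rw [hc]
  set z := c / N
  have hz : z ^ 2 * (1 - z ^ 2) ≤ 2 * (1 - Real.cos z) := by
    by_cases h : |z| ≤ 1
    · have h1 := (abs_le.1 (Real.cos_bound h)).2
      rw [(by decide : Even 4).pow_abs] at h1
      nlinarith [sq_nonneg (z ^ 2)]
    · have h1 : 1 < z ^ 2 := by rw [← sq_abs]; nlinarith [not_le.1 h]
      nlinarith [Real.cos_le_one z]
  nlinarith [sq_nonneg N]

variable {D : FPData H} {hyp : D.Hyp31}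

theorem OUData.integral_cos (O : D.OUData hyp) {t : ℝ} (ht : 0 < t) (h : H) (θ : ℝ) :
    ∫ y, Real.cos (⟪y, h⟫_ℝ + θ) ∂(O.N t) =
      Real.exp (-⟪hyp.Q t h, h⟫_ℝ / 2) * Real.cos θ := by
  have := O.N_prob t ht.le
  have hb : Integrable (fun y : H => Complex.exp ((⟪y, h⟫_ℝ : ℂ) * Complex.I)) (O.N t) := by
    refine Integrable.of_bound (by fun_prop) 1 (Eventually.of_forall fun y => ?_)
    rw [Complex.norm_exp_ofReal_mul_I]
  have h1 := O.N_char t ht h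
  have h2 : ∀ y : H, Real.cos (⟪y, h⟫_ℝ + θ) =
      Complex.reCLM (Complex.exp (θ * Complex.I) * Complex.exp ((⟪y, h⟫_ℝ : ℂ) * Complex.I)) := by
    intro y
    rw [← Complex.exp_add, ← add_mul, ← Complex.ofReal_add, Complex.reCLM_apply,
      Complex.exp_ofReal_mul_I_re, add_comm]
  simp only [h2]
  rw [ContinuousLinearMap.integral_comp_comm _ (hb.const_mul _), integral_const_mul, h1,
    ← Complex.ofReal_neg, show (2 : ℂ) = ((2 : ℝ) : ℂ) by norm_num, ← Complex.ofReal_div,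
    ← Complex.ofReal_exp, mul_comm, Complex.reCLM_apply, Complex.re_ofReal_mul,
    Complex.exp_ofReal_mul_I_re]

theorem OUData.Rop_cos (O : D.OUData hyp) {t : ℝ} (ht : 0 < t) (h : H) (θ : ℝ) (x : H) :
    O.Rop t (fun y => Real.cos (⟪y, h⟫_ℝ + θ)) x =
      Real.exp (-⟪hyp.Q t h, h⟫_ℝ / 2) * Real.cos (⟪D.S t x, h⟫_ℝ + θ) := by
  rw [Rop, ← O.integral_cos ht]
  refine integral_congr_ae (Eventually.of_forall fun y => ?_)
  simp only [inner_add_left]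
  congr 1
  ring

theorem OUData.lintegral_inner_sq_le (O : D.OUData hyp) {t : ℝ} (ht : 0 < t) (e : H) :
    ∫⁻ y, ENNReal.ofReal (⟪y, e⟫_ℝ ^ 2) ∂(O.N t) ≤ ENNReal.ofReal ⟪hyp.Q t e, e⟫_ℝ := by
  have := O.N_prob t ht.le
  set F : ℕ → H → ℝ := fun n y =>
    2 * ((n : ℝ) + 1) ^ 2 * (1 - Real.cos (⟪y, ((n : ℝ) + 1)⁻¹ • e⟫_ℝ + 0)) with hF
  have hlim : ∀ y, Tendsto (fun n => F n y) atTop (𝓝 (⟪y, e⟫_ℝ ^ 2)) := by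
    intro y
    have h1 : Tendsto (fun n : ℕ => ⟪y, e⟫_ℝ ^ 2 *
        (1 - ⟪y, e⟫_ℝ ^ 2 * (1 / ((n : ℝ) + 1)) ^ 2)) atTop (𝓝 (⟪y, e⟫_ℝ ^ 2)) := by
      have := ((tendsto_one_div_add_atTop_nhds_zero_nat (𝕜 := ℝ)).pow 2).const_mul (⟪y, e⟫_ℝ ^ 2)
      simpa using (this.const_sub 1).const_mul (⟪y, e⟫_ℝ ^ 2)
    refine tendsto_of_tendsto_of_tendsto_of_le_of_le h1 tendsto_const_nhds (fun n => ?_)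
      (fun n => ?_)
    · have := le_two_mul_sq_mul_one_sub_cos (c := ⟪y, e⟫_ℝ) (N := (n : ℝ) + 1) (by positivity)
      simp only [hF, real_inner_smul_right, add_zero]
      rw [one_div, ← div_eq_inv_mul, inv_pow, ← div_eq_mul_inv]
      exact this
    · have := two_mul_sq_mul_one_sub_cos_le (c := ⟪y, e⟫_ℝ) (N := (n : ℝ) + 1) (by positivity)
      simp only [hF, real_inner_smul_right, add_zero]
      rwa [← div_eq_inv_mul]
  have h_int : ∀ n, ∫⁻ y, ENNReal.ofReal (F n y) ∂(O.N t) ≤ ENNReal.ofReal ⟪hyp.Q t e, e⟫_ℝ := by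
    intro n
    have hn : (0 : ℝ) < (n : ℝ) + 1 := by positivity
    have hi : Integrable (fun y : H => Real.cos (⟪y, ((n : ℝ) + 1)⁻¹ • e⟫_ℝ + 0)) (O.N t) :=
      Integrable.of_bound (by fun_prop) 1 (Eventually.of_forall fun y => Real.abs_cos_le_one _)
    have hiF : Integrable (F n) (O.N t) := ((integrable_const 1).sub hi).const_mul _
    rw [← ofReal_integral_eq_lintegral_ofReal hiF (Eventually.of_forall fun y => by
      have := Real.cos_le_one (⟪y, ((n : ℝ) + 1)⁻¹ • e⟫_ℝ + 0)
      exact mul_nonneg (by positivity) (by linarith))]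
    refine ENNReal.ofReal_le_ofReal ?_
    simp only [hF]
    rw [integral_const_mul, integral_sub (integrable_const 1) hi, O.integral_cos ht]
    simp only [map_smul, real_inner_smul_left, real_inner_smul_right, integral_const,
      probReal_univ, smul_eq_mul, mul_one, Real.cos_zero]
    have h1 := Real.add_one_le_exp (-(((n : ℝ) + 1)⁻¹ * (((n : ℝ) + 1)⁻¹ * ⟪hyp.Q t e, e⟫_ℝ)) / 2)
    calc _ ≤ 2 * ((n : ℝ) + 1) ^ 2 *
          ((((n : ℝ) + 1)⁻¹ * (((n : ℝ) + 1)⁻¹ * ⟪hyp.Q t e, e⟫_ℝ)) / 2) :=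
          mul_le_mul_of_nonneg_left (by linarith) (by positivity)
      _ = _ := by field_simp
  calc ∫⁻ y, ENNReal.ofReal (⟪y, e⟫_ℝ ^ 2) ∂(O.N t)
      = ∫⁻ y, liminf (fun n => ENNReal.ofReal (F n y)) atTop ∂(O.N t) := by
        refine lintegral_congr fun y => ?_
        exact ((ENNReal.continuous_ofReal.tendsto _).comp (hlim y)).liminf_eq.symm
    _ ≤ liminf (fun n => ∫⁻ y, ENNReal.ofReal (F n y) ∂(O.N t)) atTop :=
        lintegral_liminf_le fun n => by
          simp only [hF]; fun_prop
    _ ≤ _ := liminf_le_of_le (by isBoundedDefault) fun b hb => by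
        obtain ⟨n, hn⟩ := hb.exists
        exact hn.trans (h_int n)

/-- The trace of `Q_T`, which bounds the second moments of all the measures `N_{Q_t}`. -/
noncomputable def Hyp31.trace (hyp : D.Hyp31) : ℝ :=
  ∑' i : D.ι, ⟪hyp.Q D.T (D.basis i), D.basis i⟫_ℝ

theorem Hyp31.trace_nonneg (hyp : D.Hyp31) : 0 ≤ hyp.trace :=
  tsum_nonneg fun _ => (hyp.Q_pos D.T D.hT).inner_nonneg_left _

theorem countable_basis (D : FPData H) : Countable D.ι := by
  refine Pairwise.countable_of_isOpen_disjoint (s := fun i => Metric.ball (D.basis i) (1 / 2))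
    (fun i j hij => ?_) (fun _ => Metric.isOpen_ball)
    (fun i => Metric.nonempty_ball.2 (by norm_num))
  refine Metric.ball_disjoint_ball ?_
  have h1 : ‖D.basis i - D.basis j‖ ^ 2 = 2 := by
    rw [norm_sub_sq_real, D.basis.orthonormal.1 i, D.basis.orthonormal.1 j,
      D.basis.orthonormal.2 hij]
    norm_num
  rw [dist_eq_norm]
  nlinarith [norm_nonneg (D.basis i - D.basis j)]

theorem OUData.lintegral_norm_sq_le (O : D.OUData hyp) {t : ℝ} (ht : t ∈ Icc 0 D.T) :
    ∫⁻ y, ENNReal.ofReal (‖y‖ ^ 2) ∂(O.N t) ≤ ENNReal.ofReal hyp.trace := by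
  have := D.countable_basis
  rcases ht.1.eq_or_lt with h0 | h0
  · rw [← h0, O.N_zero, lintegral_dirac]
    simp
  have h1 : ∀ y : H, ENNReal.ofReal (‖y‖ ^ 2) =
      ∑' i, ENNReal.ofReal (⟪y, D.basis i⟫_ℝ ^ 2) := by
    intro y
    have h2 := D.basis.hasSum_inner_mul_inner y y
    rw [real_inner_self_eq_norm_sq] at h2
    rw [← h2.tsum_eq, ENNReal.ofReal_tsum_of_nonneg (fun i => ?_) h2.summable]
    · simp only [real_inner_comm, sq]
    · rw [real_inner_comm]; exact mul_self_nonneg _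
  simp only [h1]
  rw [lintegral_tsum fun i => by fun_prop, Hyp31.trace, ENNReal.ofReal_tsum_of_nonneg
    (fun i => (hyp.Q_pos D.T D.hT).inner_nonneg_left _) (hyp.Q_traceClass D.T D.hT)]
  refine ENNReal.tsum_le_tsum fun i => (O.lintegral_inner_sq_le h0 _).trans ?_
  exact ENNReal.ofReal_le_ofReal (inner_Q_mono hyp h0 ht.2 _)

theorem OUData.integrable_norm_sq (O : D.OUData hyp) {t : ℝ} (ht : t ∈ Icc 0 D.T) :
    Integrable (fun y : H => ‖y‖ ^ 2) (O.N t) := by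
  refine ⟨by fun_prop, ?_⟩
  rw [hasFiniteIntegral_iff_ofReal (Eventually.of_forall fun y => by positivity)]
  exact (O.lintegral_norm_sq_le ht).trans_lt ENNReal.ofReal_lt_top

theorem OUData.integral_norm_sq_le (O : D.OUData hyp) {t : ℝ} (ht : t ∈ Icc 0 D.T) :
    ∫ y, ‖y‖ ^ 2 ∂(O.N t) ≤ hyp.trace := by
  rw [integral_eq_lintegral_of_nonneg_ae (Eventually.of_forall fun y => by positivity)
    (by fun_prop)]
  exact ENNReal.toReal_le_of_le_ofReal hyp.trace_nonneg (O.lintegral_norm_sq_le ht)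

/-- `|R_t φ(x)| ≤ c K (1 + |x|²)` whenever `|φ(y)| ≤ c (1 + |y|²)`, with `K` depending only on
the horizon. -/
theorem OUData.exists_Rop_bound (O : D.OUData hyp) : ∃ K : ℝ, 1 ≤ K ∧
    ∀ t ∈ Icc 0 D.T, ∀ x : H, ∃ b : H → ℝ, Integrable b (O.N t) ∧
      (∀ y, 1 + ‖D.S t x + y‖ ^ 2 ≤ b y) ∧ ∫ y, b y ∂(O.N t) ≤ K * (1 + ‖x‖ ^ 2) := by
  obtain ⟨M, hM1, hM⟩ := D.exists_norm_S_le
  have htr := hyp.trace_nonneg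
  refine ⟨1 + 2 * M ^ 2 + 2 * hyp.trace, by nlinarith, fun t ht x => ?_⟩
  have := O.N_prob t ht.1
  refine ⟨fun y => (1 + 2 * M ^ 2 * ‖x‖ ^ 2) + 2 * ‖y‖ ^ 2,
    (integrable_const _).add ((O.integrable_norm_sq ht).const_mul 2), fun y => ?_, ?_⟩
  · have h1 := norm_add_le (D.S t x) y
    have h2 := norm_S_apply_le hM ht x
    have h3 : ‖D.S t x + y‖ ^ 2 ≤ (M * ‖x‖ + ‖y‖) ^ 2 := by gcongr; linarith
    nlinarith [sq_nonneg (M * ‖x‖ - ‖y‖)]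
  · rw [integral_add (integrable_const _) ((O.integrable_norm_sq ht).const_mul 2),
      integral_const_mul]
    have h1 := O.integral_norm_sq_le ht
    simp only [integral_const, probReal_univ, smul_eq_mul, one_mul]
    nlinarith [sq_nonneg ‖x‖, mul_nonneg htr (sq_nonneg ‖x‖), sq_nonneg M]

theorem OUData.abs_Rop_le (O : D.OUData hyp) : ∃ K : ℝ, 1 ≤ K ∧
    ∀ t ∈ Icc 0 D.T, ∀ (φ : H → ℝ) (c : ℝ), (∀ y, |φ y| ≤ c * (1 + ‖y‖ ^ 2)) →
      ∀ x : H, |O.Rop t φ x| ≤ c * K * (1 + ‖x‖ ^ 2) := by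
  obtain ⟨K, hK, h⟩ := O.exists_Rop_bound
  refine ⟨K, hK, fun t ht φ c hφ x => ?_⟩
  obtain ⟨b, hb, hb1, hb2⟩ := h t ht x
  have hc : 0 ≤ c := by
    have := (abs_nonneg _).trans (hφ 0)
    simpa using this
  have h1 : ‖∫ y, φ (D.S t x + y) ∂(O.N t)‖ ≤ ∫ y, c * b y ∂(O.N t) :=
    norm_integral_le_of_norm_le (hb.const_mul c) (Eventually.of_forall fun y =>
      (hφ _).trans (mul_le_mul_of_nonneg_left (hb1 y) hc))
  rw [integral_const_mul] at h1
  rw [mul_assoc]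
  exact h1.trans (mul_le_mul_of_nonneg_left hb2 hc)

end FPData

namespace FPData

variable {D : FPData H} {hyp : D.Hyp31}

/-- The integrand in the definition of `G_λ f(t,x)`. -/
noncomputable def OUData.kernelG (O : D.OUData hyp) (lam : ℝ) (f : ℝ × H → ℝ) (p : ℝ × H)
    (r : ℝ) : ℝ :=
  Real.exp (-lam * (r - p.1)) * O.Rop (r - p.1) (fun y => f (r, y)) p.2

/-- `G_λ f` for a function of the pair `(t,x)`. -/
noncomputable def OUData.opG (O : D.OUData hyp) (lam : ℝ) (f : ℝ × H → ℝ) (p : ℝ × H) : ℝ :=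
  O.Gop lam (fun r y => f (r, y)) p

theorem OUData.opG_eq (O : D.OUData hyp) (lam : ℝ) (f : ℝ × H → ℝ) (p : ℝ × H) :
    O.opG lam f p = ∫ r in p.1..D.T, O.kernelG lam f p r := rfl

/-- Continuous functions, bounded on `[0,T] × H`, whose `G_λ` is given by a genuine integral. -/
structure OUData.Admissible (O : D.OUData hyp) (lam : ℝ) (f : ℝ × H → ℝ) : Prop where
  cont : Continuous f
  bdd : ∃ c : ℝ, ∀ p : ℝ × H, p.1 ∈ Icc 0 D.T → |f p| ≤ c
  int : ∀ p : ℝ × H, p.1 ∈ Icc 0 D.T →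
    IntervalIntegrable (O.kernelG lam f p) volume p.1 D.T

/-- `f` is admissible and `(G_λ f, V G_λ f)` is a uniform limit, with weight `1 + |x|²`, of
pairs `(v, V₀ v)`. -/
def OUData.Approximable (O : D.OUData hyp) (lam : ℝ) (f : ℝ × H → ℝ) : Prop :=
  O.Admissible lam f ∧ ∀ ε > 0, ∃ v w, D.IsOUPair v w ∧ ∀ p : ℝ × H, p.1 ∈ Icc 0 D.T →
    |v p - O.opG lam f p| ≤ ε * (1 + ‖p.2‖ ^ 2) ∧
    |w p - (lam * O.opG lam f p - f p)| ≤ ε * (1 + ‖p.2‖ ^ 2)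

variable {O : D.OUData hyp} {lam : ℝ} {f f' : ℝ × H → ℝ}

theorem sub_mem_horizon {p : ℝ × H} (hp : p.1 ∈ Icc 0 D.T) {r : ℝ} (hr : r ∈ uIcc p.1 D.T) :
    r ∈ Icc 0 D.T ∧ r - p.1 ∈ Icc 0 D.T := by
  rw [uIcc_of_le hp.2] at hr
  exact ⟨⟨hp.1.trans hr.1, hr.2⟩, by linarith [hr.1], by linarith [hr.2, hp.1]⟩

theorem OUData.Admissible.integrable (h : O.Admissible lam f) {p : ℝ × H}
    (hp : p.1 ∈ Icc 0 D.T) {r : ℝ} (hr : r ∈ uIcc p.1 D.T) :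
    Integrable (fun y => f (r, D.S (r - p.1) p.2 + y)) (O.N (r - p.1)) := by
  obtain ⟨h1, h2⟩ := sub_mem_horizon hp hr
  have := O.N_prob _ h2.1
  obtain ⟨c, hc⟩ := h.bdd
  have hcont := h.cont
  exact Integrable.of_bound (by fun_prop) c (Eventually.of_forall fun y => hc _ h1)

theorem OUData.Admissible.kernelG_add (h : O.Admissible lam f) (h' : O.Admissible lam f')
    {p : ℝ × H} (hp : p.1 ∈ Icc 0 D.T) {r : ℝ} (hr : r ∈ uIcc p.1 D.T) :
    O.kernelG lam (f + f') p r = O.kernelG lam f p r + O.kernelG lam f' p r := by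
  simp only [kernelG, Rop, Pi.add_apply]
  rw [integral_add (h.integrable hp hr) (h'.integrable hp hr), mul_add]

theorem OUData.kernelG_smul (O : D.OUData hyp) (lam : ℝ) (f : ℝ × H → ℝ) (a : ℝ) (p : ℝ × H)
    (r : ℝ) : O.kernelG lam (a • f) p r = a * O.kernelG lam f p r := by
  simp only [kernelG, Rop, Pi.smul_apply, smul_eq_mul]
  rw [integral_const_mul]
  ring

theorem OUData.opG_smul (O : D.OUData hyp) (lam : ℝ) (f : ℝ × H → ℝ) (a : ℝ) (p : ℝ × H) :
    O.opG lam (a • f) p = a * O.opG lam f p := by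
  simp only [opG_eq, kernelG_smul, intervalIntegral.integral_const_mul]

theorem OUData.Admissible.opG_add (h : O.Admissible lam f) (h' : O.Admissible lam f')
    {p : ℝ × H} (hp : p.1 ∈ Icc 0 D.T) :
    O.opG lam (f + f') p = O.opG lam f p + O.opG lam f' p := by
  simp only [opG_eq]
  rw [← intervalIntegral.integral_add (h.int p hp) (h'.int p hp)]
  exact intervalIntegral.integral_congr fun r hr => h.kernelG_add h' hp hr

theorem OUData.Admissible.add (h : O.Admissible lam f) (h' : O.Admissible lam f') :
    O.Admissible lam (f + f') := by
  refine ⟨h.cont.add h'.cont, ?_, fun p hp => ?_⟩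
  · obtain ⟨c, hc⟩ := h.bdd
    obtain ⟨c', hc'⟩ := h'.bdd
    exact ⟨c + c', fun p hp => (abs_add_le _ _).trans (add_le_add (hc p hp) (hc' p hp))⟩
  · refine ((h.int p hp).add (h'.int p hp)).congr fun r hr => ?_
    exact (h.kernelG_add h' hp (uIoc_subset_uIcc hr)).symm

theorem OUData.Admissible.smul (h : O.Admissible lam f) (a : ℝ) :
    O.Admissible lam (a • f) := by
  refine ⟨h.cont.const_smul a, ?_, fun p hp => ?_⟩
  · obtain ⟨c, hc⟩ := h.bdd
    refine ⟨|a| * c, fun p hp => ?_⟩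
    rw [Pi.smul_apply, smul_eq_mul, abs_mul]
    exact mul_le_mul_of_nonneg_left (hc p hp) (abs_nonneg _)
  · refine ((h.int p hp).const_mul a).congr fun r _ => ?_
    exact (O.kernelG_smul lam f a p r).symm

theorem OUData.admissible_zero (O : D.OUData hyp) (lam : ℝ) : O.Admissible lam 0 := by
  refine ⟨continuous_zero, ⟨0, by simp⟩, fun p _ => ?_⟩
  refine (_root_.intervalIntegrable_const (c := (0 : ℝ))).congr fun r _ => ?_
  simp [kernelG, Rop]

theorem OUData.approximable_zero (O : D.OUData hyp) (lam : ℝ) : O.Approximable lam 0 := by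
  refine ⟨O.admissible_zero lam, fun ε hε => ⟨0, 0, D.isOUPair_zero, fun p _ => ?_⟩⟩
  have : O.opG lam 0 p = 0 := by simp [opG_eq, kernelG, Rop]
  rw [this]
  have : 0 ≤ ε * (1 + ‖p.2‖ ^ 2) := by positivity
  simpa using this

theorem OUData.Approximable.add (h : O.Approximable lam f) (h' : O.Approximable lam f') :
    O.Approximable lam (f + f') := by
  refine ⟨h.1.add h'.1, fun ε hε => ?_⟩
  obtain ⟨v, w, hv, hb⟩ := h.2 (ε / 2) (half_pos hε)
  obtain ⟨v', w', hv', hb'⟩ := h'.2 (ε / 2) (half_pos hε)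
  refine ⟨v + v', w + w', hv.add hv', fun p hp => ?_⟩
  rw [h.1.opG_add h'.1 hp]
  obtain ⟨h1, h2⟩ := hb p hp
  obtain ⟨h1', h2'⟩ := hb' p hp
  simp only [Pi.add_apply]
  rw [abs_le] at h1 h2 h1' h2' ⊢
  rw [abs_le]
  refine ⟨⟨?_, ?_⟩, ?_, ?_⟩ <;> linarith

theorem OUData.Approximable.smul (h : O.Approximable lam f) (a : ℝ) :
    O.Approximable lam (a • f) := by
  refine ⟨h.1.smul a, fun ε hε => ?_⟩
  obtain ⟨v, w, hv, hb⟩ := h.2 (ε / (|a| + 1)) (by positivity)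
  refine ⟨a • v, a • w, hv.smul a, fun p hp => ?_⟩
  obtain ⟨h1, h2⟩ := hb p hp
  have ha : |a| * (ε / (|a| + 1) * (1 + ‖p.2‖ ^ 2)) ≤ ε * (1 + ‖p.2‖ ^ 2) := by
    rw [← mul_assoc]
    refine mul_le_mul_of_nonneg_right ?_ (by positivity)
    rw [mul_div_assoc', div_le_iff₀ (by positivity)]
    nlinarith [abs_nonneg a]
  rw [O.opG_smul]
  simp only [Pi.smul_apply, smul_eq_mul]
  constructor
  · rw [← mul_sub, abs_mul]
    exact (mul_le_mul_of_nonneg_left h1 (abs_nonneg a)).trans ha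
  · rw [show a * w p - (lam * (a * O.opG lam f p) - a * f p) =
      a * (w p - (lam * O.opG lam f p - f p)) by ring, abs_mul]
    exact (mul_le_mul_of_nonneg_left h2 (abs_nonneg a)).trans ha

/-- `G_λ` is bounded for the weighted sup norm. -/
theorem OUData.exists_abs_kernelG_le (O : D.OUData hyp) (lam : ℝ) : ∃ K : ℝ, 1 ≤ K ∧
    ∀ (f : ℝ × H → ℝ) (c : ℝ), ∀ p : ℝ × H, p.1 ∈ Icc 0 D.T → ∀ r ∈ uIcc p.1 D.T,
      (∀ y, |f (r, y)| ≤ c * (1 + ‖y‖ ^ 2)) →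
      |O.kernelG lam f p r| ≤ c * K * (1 + ‖p.2‖ ^ 2) := by
  obtain ⟨K, hK, h⟩ := O.abs_Rop_le
  have hE : 1 ≤ Real.exp (|lam| * D.T) := Real.one_le_exp (mul_nonneg (abs_nonneg _) D.hT.le)
  refine ⟨Real.exp (|lam| * D.T) * K, by nlinarith, fun f c p hp r hr hf => ?_⟩
  obtain ⟨h1, h2⟩ := sub_mem_horizon hp hr
  have h3 := h _ h2 (fun y => f (r, y)) c hf p.2
  rw [kernelG, abs_mul, Real.abs_exp]
  have h4 : Real.exp (-lam * (r - p.1)) ≤ Real.exp (|lam| * D.T) := by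
    refine Real.exp_le_exp.2 (mul_le_mul (neg_le_abs lam) h2.2 h2.1 (abs_nonneg _))
  calc _ ≤ Real.exp (|lam| * D.T) * (c * K * (1 + ‖p.2‖ ^ 2)) :=
        mul_le_mul h4 h3 (abs_nonneg _) (Real.exp_pos _).le
    _ = _ := by ring

end FPData

namespace FPData

/-- Families of functions on `[0,T] × H`, depending on a parameter `s ∈ [0,T]` uniformly
continuously with respect to the weight `(1 + |x|)^j`. -/
structure TameFamily (T : ℝ) (j : ℕ) (F : ℝ → ℝ × H → ℝ) : Prop where
  bdd : ∃ M : ℝ, 0 ≤ M ∧ ∀ s ∈ Icc 0 T, ∀ p : ℝ × H, p.1 ∈ Icc 0 T →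
    |F s p| ≤ M * (1 + ‖p.2‖) ^ j
  equi : ∀ ε > 0, ∃ δ > 0, ∀ s ∈ Icc 0 T, ∀ s' ∈ Icc 0 T, |s - s'| < δ →
    ∀ p : ℝ × H, p.1 ∈ Icc 0 T → |F s p - F s' p| ≤ ε * (1 + ‖p.2‖) ^ j

namespace TameFamily

variable {T : ℝ} {j j' : ℕ} {F F' : ℝ → ℝ × H → ℝ}

theorem mono (h : TameFamily T j F) (hj : j ≤ j') : TameFamily T j' F := by
  have hw : ∀ p : ℝ × H, (1 + ‖p.2‖) ^ j ≤ (1 + ‖p.2‖) ^ j' := fun p =>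
    pow_le_pow_right₀ (by linarith [norm_nonneg p.2]) hj
  refine ⟨?_, fun ε hε => ?_⟩
  · obtain ⟨M, hM, hb⟩ := h.bdd
    exact ⟨M, hM, fun s hs p hp => (hb s hs p hp).trans
      (mul_le_mul_of_nonneg_left (hw p) hM)⟩
  · obtain ⟨δ, hδ, hb⟩ := h.equi ε hε
    exact ⟨δ, hδ, fun s hs s' hs' hss p hp => (hb s hs s' hs' hss p hp).trans
      (mul_le_mul_of_nonneg_left (hw p) hε.le)⟩

theorem add (h : TameFamily T j F) (h' : TameFamily T j F') :
    TameFamily T j (fun s p => F s p + F' s p) := by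
  refine ⟨?_, fun ε hε => ?_⟩
  · obtain ⟨M, hM, hb⟩ := h.bdd
    obtain ⟨M', hM', hb'⟩ := h'.bdd
    refine ⟨M + M', by positivity, fun s hs p hp => (abs_add_le _ _).trans ?_⟩
    rw [add_mul]
    exact add_le_add (hb s hs p hp) (hb' s hs p hp)
  · obtain ⟨δ, hδ, hb⟩ := h.equi (ε / 2) (half_pos hε)
    obtain ⟨δ', hδ', hb'⟩ := h'.equi (ε / 2) (half_pos hε)
    refine ⟨min δ δ', lt_min hδ hδ', fun s hs s' hs' hss p hp => ?_⟩
    have h1 := hb s hs s' hs' (hss.trans_le (min_le_left _ _)) p hp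
    have h2 := hb' s hs s' hs' (hss.trans_le (min_le_right _ _)) p hp
    rw [add_sub_add_comm]
    refine (abs_add_le _ _).trans ?_
    linarith

theorem mul (h : TameFamily T j F) (h' : TameFamily T j' F') :
    TameFamily T (j + j') (fun s p => F s p * F' s p) := by
  obtain ⟨M, hM, hb⟩ := h.bdd
  obtain ⟨M', hM', hb'⟩ := h'.bdd
  have hw : ∀ (i : ℕ) (p : ℝ × H), 0 ≤ (1 + ‖p.2‖) ^ i := fun i p => by positivity
  refine ⟨⟨M * M', by positivity, fun s hs p hp => ?_⟩, fun ε hε => ?_⟩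
  · rw [abs_mul, pow_add, mul_mul_mul_comm]
    exact mul_le_mul (hb s hs p hp) (hb' s hs p hp) (abs_nonneg _) (mul_nonneg hM (hw _ _))
  · obtain ⟨δ, hδ, he⟩ := h.equi (ε / (2 * (M' + 1))) (by positivity)
    obtain ⟨δ', hδ', he'⟩ := h'.equi (ε / (2 * (M + 1))) (by positivity)
    refine ⟨min δ δ', lt_min hδ hδ', fun s hs s' hs' hss p hp => ?_⟩
    have h1 := he s hs s' hs' (hss.trans_le (min_le_left _ _)) p hp
    have h2 := he' s hs s' hs' (hss.trans_le (min_le_right _ _)) p hp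
    have h3 := mul_le_mul h1 (hb' s hs p hp) (abs_nonneg _) (mul_nonneg (by positivity) (hw _ _))
    have h4 := mul_le_mul (hb s' hs' p hp) h2 (abs_nonneg _) (mul_nonneg hM (hw _ _))
    have e1 : ε / (2 * (M' + 1)) * M' ≤ ε / 2 := by
      rw [div_mul_eq_mul_div, div_le_iff₀ (by positivity)]
      nlinarith
    have e2 : M * (ε / (2 * (M + 1))) ≤ ε / 2 := by
      rw [mul_div_assoc', div_le_iff₀ (by positivity)]
      nlinarith
    have hW := mul_nonneg (hw j p) (hw j' p)
    have h5 := mul_le_mul_of_nonneg_right e1 hW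
    have h6 := mul_le_mul_of_nonneg_right e2 hW
    rw [show F s p * F' s p - F s' p * F' s' p =
      (F s p - F s' p) * F' s p + F s' p * (F' s p - F' s' p) by ring]
    refine (abs_add_le _ _).trans ?_
    rw [abs_mul, abs_mul, pow_add]
    nlinarith

theorem of_continuous {a : ℝ → ℝ} (ha : Continuous a) (T : ℝ) :
    TameFamily T 0 (fun s (_ : ℝ × H) => a s) := by
  refine ⟨?_, fun ε hε => ?_⟩
  · obtain ⟨M, hM⟩ := isCompact_Icc.exists_bound_of_continuousOn (s := Icc 0 T) ha.continuousOn
    refine ⟨|M|, abs_nonneg _, fun s hs p _ => ?_⟩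
    simpa using (hM s hs).trans (le_abs_self M)
  · obtain ⟨δ, hδ, h⟩ := Metric.uniformContinuousOn_iff.1
      (isCompact_Icc.uniformContinuousOn_of_continuous (s := Icc 0 T) ha.continuousOn) ε hε
    refine ⟨δ, hδ, fun s hs s' hs' hss p _ => ?_⟩
    simpa [Real.dist_eq] using (h s hs s' hs' hss).le

theorem shift {a : ℝ → ℝ} (ha : Continuous a) (T : ℝ) :
    TameFamily T 0 (fun s (p : ℝ × H) => a (p.1 + s)) := by
  have hmem : ∀ s ∈ Icc 0 T, ∀ p : ℝ × H, p.1 ∈ Icc 0 T → p.1 + s ∈ Icc 0 (T + T) :=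
    fun s hs p hp => ⟨add_nonneg hp.1 hs.1, add_le_add hp.2 hs.2⟩
  refine ⟨?_, fun ε hε => ?_⟩
  · obtain ⟨M, hM⟩ := isCompact_Icc.exists_bound_of_continuousOn (s := Icc 0 (T + T))
      ha.continuousOn
    refine ⟨|M|, abs_nonneg _, fun s hs p hp => ?_⟩
    simpa using (hM _ (hmem s hs p hp)).trans (le_abs_self M)
  · obtain ⟨δ, hδ, h⟩ := Metric.uniformContinuousOn_iff.1
      (isCompact_Icc.uniformContinuousOn_of_continuous (s := Icc 0 (T + T)) ha.continuousOn) ε hε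
    refine ⟨δ, hδ, fun s hs s' hs' hss p hp => ?_⟩
    have := h _ (hmem s hs p hp) _ (hmem s' hs' p hp) (by simpa [Real.dist_eq] using hss)
    simpa [Real.dist_eq] using this.le

theorem inner_right {z : ℝ → H} (hz : Continuous z) (T : ℝ) :
    TameFamily T 1 (fun s (p : ℝ × H) => ⟪p.2, z s⟫_ℝ) := by
  refine ⟨?_, fun ε hε => ?_⟩
  · obtain ⟨M, hM⟩ := isCompact_Icc.exists_bound_of_continuousOn (s := Icc 0 T) hz.continuousOn
    refine ⟨|M|, abs_nonneg _, fun s hs p _ => (abs_real_inner_le_norm _ _).trans ?_⟩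
    rw [pow_one, mul_comm]
    exact mul_le_mul ((hM s hs).trans (le_abs_self M)) (by linarith) (norm_nonneg _)
      (abs_nonneg _)
  · obtain ⟨δ, hδ, h⟩ := Metric.uniformContinuousOn_iff.1
      (isCompact_Icc.uniformContinuousOn_of_continuous (s := Icc 0 T) hz.continuousOn) ε hε
    refine ⟨δ, hδ, fun s hs s' hs' hss p _ => ?_⟩
    have h1 := (h s hs s' hs' hss).le
    rw [dist_eq_norm] at h1
    rw [← inner_sub_right, pow_one, mul_comm]
    refine (abs_real_inner_le_norm _ _).trans ?_
    exact mul_le_mul (by linarith) h1 (norm_nonneg _) (by positivity)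

theorem comp_one_lipschitz (h : TameFamily T j F) {c : ℝ → ℝ} (hc : ∀ a, |c a| ≤ 1)
    (hl : ∀ a b, |c a - c b| ≤ |a - b|) : TameFamily T j (fun s p => c (F s p)) := by
  refine ⟨⟨1, zero_le_one, fun s _ p _ => ?_⟩, fun ε hε => ?_⟩
  · rw [one_mul]
    exact (hc _).trans (one_le_pow₀ (by linarith [norm_nonneg p.2]))
  · obtain ⟨δ, hδ, hb⟩ := h.equi ε hε
    exact ⟨δ, hδ, fun s hs s' hs' hss p hp => (hl _ _).trans (hb s hs s' hs' hss p hp)⟩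

theorem cos (h : TameFamily T j F) (θ : ℝ) :
    TameFamily T j (fun s p => Real.cos (F s p + θ)) :=
  h.comp_one_lipschitz (c := fun a => Real.cos (a + θ)) (fun _ => Real.abs_cos_le_one _)
    fun a b => by
      have := Real.lipschitzWith_cos.dist_le_mul (a + θ) (b + θ)
      simpa [Real.dist_eq] using this

theorem sin (h : TameFamily T j F) (θ : ℝ) :
    TameFamily T j (fun s p => Real.sin (F s p + θ)) :=
  h.comp_one_lipschitz (c := fun a => Real.sin (a + θ)) (fun _ => Real.abs_sin_le_one _)
    fun a b => by
      have := Real.lipschitzWith_sin.dist_le_mul (a + θ) (b + θ)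
      simpa [Real.dist_eq] using this

/-- Riemann sums of a tame family converge uniformly, relatively to the weight. -/
theorem riemann_sum (h : TameFamily T j F) (hT : 0 < T) (hF : ∀ p, Continuous fun s => F s p)
    {ε : ℝ} (hε : 0 < ε) : ∃ N : ℕ, ∀ m : ℕ, N < m → ∀ p : ℝ × H, p.1 ∈ Icc 0 T →
      |∑ i ∈ Finset.range m, T / m * F (i * (T / m)) p - ∫ s in (0 : ℝ)..T, F s p| ≤
        ε * (1 + ‖p.2‖) ^ j := by
  obtain ⟨δ, hδ, hb⟩ := h.equi (ε / T) (by positivity)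
  obtain ⟨N, hN⟩ := exists_nat_gt (T / δ)
  refine ⟨N, fun m hm p hp => ?_⟩
  have hm0 : (0 : ℝ) < m := by
    have : (N : ℝ) < m := by exact_mod_cast hm
    exact (Nat.cast_nonneg N).trans_lt this
  set d := T / m with hd
  have hd0 : 0 < d := by positivity
  have hdδ : d < δ := by
    rw [hd, div_lt_iff₀ hm0]
    rw [div_lt_iff₀ hδ] at hN
    have : (N : ℝ) < m := by exact_mod_cast hm
    nlinarith
  have hTd : (m : ℝ) * d = T := by rw [hd]; field_simp
  have hsum := intervalIntegral.sum_integral_adjacent_intervals (f := fun s => F s p)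
    (μ := volume) (a := fun i : ℕ => (i : ℝ) * d) (n := m)
    (fun k _ => (hF p).intervalIntegrable _ _)
  simp only [Nat.cast_zero, zero_mul, hTd] at hsum
  rw [← hsum, ← Finset.sum_sub_distrib]
  refine (Finset.abs_sum_le_sum_abs _ _).trans ?_
  have hterm : ∀ i ∈ Finset.range m, |d * F (i * d) p -
      ∫ s in (i : ℝ) * d..((i + 1 : ℕ) : ℝ) * d, F s p| ≤ d * (ε / T * (1 + ‖p.2‖) ^ j) := by
    intro i hi
    have hlen : ((i + 1 : ℕ) : ℝ) * d - i * d = d := by push_cast; ring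
    have hle : (i : ℝ) * d ≤ ((i + 1 : ℕ) : ℝ) * d := by linarith
    have hiT : ((i + 1 : ℕ) : ℝ) * d ≤ T := by
      rw [← hTd]
      refine mul_le_mul_of_nonneg_right ?_ hd0.le
      exact_mod_cast Finset.mem_range.1 hi
    have hi0 : 0 ≤ (i : ℝ) * d := by positivity
    have h1 : d * F (i * d) p = ∫ s in (i : ℝ) * d..((i + 1 : ℕ) : ℝ) * d, F (i * d) p := by
      rw [intervalIntegral.integral_const, hlen, smul_eq_mul]
    rw [h1, ← intervalIntegral.integral_sub (by simp) ((hF p).intervalIntegrable _ _)]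
    have h2 := intervalIntegral.norm_integral_le_of_norm_le_const
      (f := fun s => F (i * d) p - F s p) (a := (i : ℝ) * d) (b := ((i + 1 : ℕ) : ℝ) * d)
      (C := ε / T * (1 + ‖p.2‖) ^ j) (fun s hs => ?_)
    · rw [hlen, abs_of_pos hd0] at h2
      exact h2.trans_eq (mul_comm _ _)
    · rw [uIoc_of_le hle] at hs
      refine hb _ ⟨hi0, hle.trans hiT⟩ _ ⟨hi0.trans hs.1.le, hs.2.trans hiT⟩ ?_ p hp
      rw [abs_sub_comm, abs_of_pos (by linarith [hs.1])]
      linarith [hs.2]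
  refine (Finset.sum_le_sum hterm).trans ?_
  rw [Finset.sum_const, Finset.card_range, nsmul_eq_mul, ← mul_assoc, hTd, ← mul_assoc,
    mul_div_cancel₀ _ hT.ne']

end TameFamily

end FPData

namespace FPData

/-- The orbit `s ↦ e^{sA*} h`, frozen outside `[0,T]`. -/
noncomputable def adjOrbit (D : FPData H) (h : H) (s : ℝ) : H :=
  ContinuousLinearMap.adjoint (D.S (projIcc 0 D.T D.hT.le s)) h

theorem adjOrbit_of_mem (D : FPData H) (h : H) {s : ℝ} (hs : s ∈ Icc 0 D.T) :
    D.adjOrbit h s = ContinuousLinearMap.adjoint (D.S s) h := by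
  rw [adjOrbit, projIcc_of_mem _ hs]

theorem inner_adjOrbit (D : FPData H) (h x : H) {s : ℝ} (hs : s ∈ Icc 0 D.T) :
    ⟪x, D.adjOrbit h s⟫_ℝ = ⟪D.S s x, h⟫_ℝ := by
  rw [adjOrbit_of_mem D h hs, ContinuousLinearMap.adjoint_inner_right]

section

variable {D : FPData H} {h g : H}

theorem IsRegularPair.continuous_fst (hp : D.IsRegularPair h g) : Continuous (D.adjOrbit h) :=
  hp.continuousOn_fst.comp_continuous (continuous_subtype_val.comp continuous_projIcc)
    fun s => (projIcc 0 D.T D.hT.le s).2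

theorem IsRegularPair.continuous_snd (hp : D.IsRegularPair h g) : Continuous (D.adjOrbit g) :=
  hp.continuousOn_snd.comp_continuous (continuous_subtype_val.comp continuous_projIcc)
    fun s => (projIcc 0 D.T D.hT.le s).2

theorem IsRegularPair.hasDerivAt_inner (hp : D.IsRegularPair h g) (x : H) {s : ℝ}
    (hs : s ∈ Ioo 0 D.T) :
    HasDerivAt (fun s => ⟪x, D.adjOrbit h s⟫_ℝ) ⟪x, D.adjOrbit g s⟫_ℝ s := by
  have hc : Continuous fun s => ⟪x, D.adjOrbit g s⟫_ℝ := continuous_const.inner hp.continuous_snd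
  have h1 := (intervalIntegral.integral_hasDerivAt_right (hc.intervalIntegrable 0 s)
    (hc.stronglyMeasurableAtFilter _ _) hc.continuousAt).const_add ⟪x, h⟫_ℝ
  refine h1.congr_of_eventuallyEq ?_
  filter_upwards [Ioo_mem_nhds hs.1 hs.2] with r hr
  have h2 := hp.pair x r hr.1.le
  rw [D.inner_adjOrbit h x (Ioo_subset_Icc_self hr), ← sub_eq_iff_eq_add', h2]
  refine intervalIntegral.integral_congr fun q hq => ?_
  rw [uIcc_of_le hr.1.le] at hq
  exact (D.inner_adjOrbit g x ⟨hq.1, hq.2.trans hr.2.le⟩).symm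

end

/-- The damping factor `e^{-λ s - ⟨Q_s h, h⟩ / 2}`. -/
noncomputable def damp (D : FPData H) (lam : ℝ) (h : H) (s : ℝ) : ℝ :=
  Real.exp (-lam * s - (∫ r in (0 : ℝ)..s, ⟪D.C (D.adjOrbit h r), D.adjOrbit h r⟫_ℝ) / 2)

section

variable {D : FPData H} {hyp : D.Hyp31} {h g : H}

theorem IsRegularPair.hasDerivAt_damp (hp : D.IsRegularPair h g) (lam s : ℝ) :
    HasDerivAt (D.damp lam h)
      (D.damp lam h s * (-lam - ⟪D.C (D.adjOrbit h s), D.adjOrbit h s⟫_ℝ / 2)) s := by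
  have hk := hp.continuous_fst
  have hc : Continuous fun r => ⟪D.C (D.adjOrbit h r), D.adjOrbit h r⟫_ℝ := by fun_prop
  have h1 := (intervalIntegral.integral_hasDerivAt_right (hc.intervalIntegrable 0 s)
    (hc.stronglyMeasurableAtFilter _ _) hc.continuousAt).div_const 2
  have h2 := (((hasDerivAt_id s).const_mul (-lam)).sub h1).exp
  rw [mul_one] at h2
  exact h2

theorem IsRegularPair.continuous_damp (hp : D.IsRegularPair h g) (lam : ℝ) :
    Continuous (D.damp lam h) :=
  continuous_iff_continuousAt.2 fun s => (hp.hasDerivAt_damp lam s).continuousAt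

theorem damp_zero (D : FPData H) (lam : ℝ) (h : H) : D.damp lam h 0 = 1 := by
  simp [damp]

theorem IsRegularPair.exp_mul_exp (hp : D.IsRegularPair h g) (hyp : D.Hyp31) (lam : ℝ) {s : ℝ}
    (h0 : 0 < s) (hT : s ≤ D.T) :
    Real.exp (-lam * s) * Real.exp (-⟪hyp.Q s h, h⟫_ℝ / 2) = D.damp lam h s := by
  rw [damp, ← Real.exp_add, hp.inner_Q hyp h0 hT]
  congr 1
  rw [neg_div, ← sub_eq_add_neg]
  congr 2
  refine intervalIntegral.integral_congr fun r hr => ?_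
  rw [uIcc_of_le h0.le] at hr
  simp only [D.adjOrbit_of_mem h (⟨hr.1, hr.2.trans hT⟩ : r ∈ Icc 0 D.T)]

/-- The plane wave `φ(t) cos(⟨x,h⟩ + θ)`. -/
noncomputable def wave (φ : ℝ → ℝ) (h : H) (θ : ℝ) (p : ℝ × H) : ℝ :=
  φ p.1 * Real.cos (⟪p.2, h⟫_ℝ + θ)

theorem OUData.kernelG_wave (O : D.OUData hyp) (lam : ℝ) (hp : D.IsRegularPair h g) (φ : ℝ → ℝ)
    (θ : ℝ) {p : ℝ × H} (hpT : p.1 ∈ Icc 0 D.T) {r : ℝ} (hr : r ∈ uIcc p.1 D.T) :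
    O.kernelG lam (wave φ h θ) p r = D.damp lam h (r - p.1) *
      (φ r * Real.cos (⟪p.2, D.adjOrbit h (r - p.1)⟫_ℝ + θ)) := by
  obtain ⟨-, h2⟩ := sub_mem_horizon hpT hr
  rw [D.inner_adjOrbit h p.2 h2]
  rcases h2.1.eq_or_lt with h0 | h0
  · rw [kernelG, ← h0, damp_zero, Rop, O.N_zero, integral_dirac]
    simp [wave, D.S_zero]
  · rw [← hp.exp_mul_exp hyp lam h0 h2.2, kernelG]
    have h3 := O.Rop_cos h0 h θ p.2
    rw [Rop] at h3 ⊢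
    simp only [wave]
    rw [integral_const_mul, h3]
    ring

theorem OUData.admissible_wave (O : D.OUData hyp) (lam : ℝ) (hp : D.IsRegularPair h g)
    {φ : ℝ → ℝ} (hφ : Continuous φ) (θ : ℝ) : O.Admissible lam (wave φ h θ) := by
  refine ⟨by unfold wave; fun_prop, ?_, fun p hpT => ?_⟩
  · obtain ⟨M, hM⟩ := isCompact_Icc.exists_bound_of_continuousOn (s := Icc 0 D.T) hφ.continuousOn
    refine ⟨M, fun p hpT => ?_⟩
    rw [wave, abs_mul]
    exact (mul_le_of_le_one_right (abs_nonneg _) (Real.abs_cos_le_one _)).trans (hM _ hpT)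
  · have hk := hp.continuous_fst
    have hd := hp.continuous_damp lam
    have hc : Continuous fun r => D.damp lam h (r - p.1) *
      (φ r * Real.cos (⟪p.2, D.adjOrbit h (r - p.1)⟫_ℝ + θ)) := by fun_prop
    exact (hc.intervalIntegrable _ _).congr fun r hr =>
      (O.kernelG_wave lam hp φ θ hpT (uIoc_subset_uIcc hr)).symm

end

end FPData

namespace FPData

variable {D : FPData H} {hyp : D.Hyp31} {h g : H}

theorem one_add_sq_le (a : ℝ) : (1 + a) ^ 2 ≤ 2 * (1 + a ^ 2) := by
  nlinarith [sq_nonneg (1 - a)]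

theorem OUData.approximable_wave_of_vanishing (O : D.OUData hyp) (lam : ℝ)
    (hp : D.IsRegularPair h g) {φ φd : ℝ → ℝ} (hφ : ∀ t, HasDerivAt φ (φd t) t)
    (hφd : Continuous φd) (hφT : ∀ t, D.T ≤ t → φ t = 0) (θ : ℝ) :
    O.Approximable lam (wave φ h θ) := by
  have hφc : Continuous φ := continuous_iff_continuousAt.2 fun t => (hφ t).continuousAt
  refine ⟨O.admissible_wave lam hp hφc θ, fun ε hε => ?_⟩
  have hK := hp.continuous_fst
  have hL := hp.continuous_snd
  have hd := hp.continuous_damp lam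
  set K := D.adjOrbit h with hKdef
  set Lo := D.adjOrbit g with hLdef
  set a := D.damp lam h with hadef
  set F : ℝ → ℝ × H → ℝ := fun s p => a s * (φ (p.1 + s) * Real.cos (⟪p.2, K s⟫_ℝ + θ)) with hF
  set W : ℝ → ℝ × H → ℝ := fun s p =>
    a s * D.waveV (fun t => φ (t + s)) (fun t => φd (t + s)) (K s) (Lo s) θ p with hW
  have hFc : ∀ p, Continuous fun s => F s p := fun p => by simp only [hF]; fun_prop
  have hWc : ∀ p, Continuous fun s => W s p := fun p => by simp only [hW, waveV]; fun_prop
  have tK : TameFamily D.T 1 (fun s (p : ℝ × H) => ⟪p.2, K s⟫_ℝ) := TameFamily.inner_right hK _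
  have tL : TameFamily D.T 1 (fun s (p : ℝ × H) => ⟪p.2, Lo s⟫_ℝ) := TameFamily.inner_right hL _
  have ta : TameFamily D.T 0 (fun s (_ : ℝ × H) => a s) := TameFamily.of_continuous hd _
  have tq : TameFamily D.T 0 (fun s (_ : ℝ × H) => a s * (-(1 / 2) * ⟪D.C (K s), K s⟫_ℝ)) :=
    TameFamily.of_continuous (by fun_prop) _
  have tn : TameFamily D.T 0 (fun s (_ : ℝ × H) => -a s) :=
    TameFamily.of_continuous (by fun_prop) _
  have tφ : TameFamily D.T 0 (fun s (p : ℝ × H) => φ (p.1 + s)) := TameFamily.shift hφc _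
  have tφd : TameFamily D.T 0 (fun s (p : ℝ × H) => φd (p.1 + s)) := TameFamily.shift hφd _
  have hFt : TameFamily D.T 2 F := (ta.mul (tφ.mul (tK.cos θ))).mono (by norm_num)
  have hWt : TameFamily D.T 2 W := by
    have h1 : TameFamily D.T 2 _ := (ta.mul (tφd.mul (tK.cos θ))).mono (by norm_num)
    have h2 : TameFamily D.T 2 _ := (tq.mul (tφ.mul (tK.cos θ))).mono (by norm_num)
    have h3 : TameFamily D.T 2 _ := (tn.mul (tφ.mul (tL.mul (tK.sin θ)))).mono (by norm_num)
    have h4 := (h1.add h2).add h3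
    have e : W = fun s p => a s * (φd (p.1 + s) * Real.cos (⟪p.2, K s⟫_ℝ + θ)) +
        a s * (-(1 / 2) * ⟪D.C (K s), K s⟫_ℝ) * (φ (p.1 + s) * Real.cos (⟪p.2, K s⟫_ℝ + θ)) +
        -a s * (φ (p.1 + s) * (⟪p.2, Lo s⟫_ℝ * Real.sin (⟪p.2, K s⟫_ℝ + θ))) := by
      funext s p
      simp only [hW, waveV]
      ring
    rw [e]
    exact h4
  have hFint : ∀ p : ℝ × H, p.1 ∈ Icc 0 D.T →
      ∫ s in (0 : ℝ)..D.T, F s p = O.opG lam (wave φ h θ) p := by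
    intro p hpT
    have hR : O.opG lam (wave φ h θ) p = ∫ r in p.1..D.T, F (r - p.1) p := by
      rw [O.opG_eq]
      refine intervalIntegral.integral_congr fun r hr => ?_
      simp only [hF, add_sub_cancel]
      exact O.kernelG_wave lam hp φ θ hpT hr
    rw [hR, intervalIntegral.integral_comp_sub_right (fun s => F s p), sub_self,
      ← intervalIntegral.integral_add_adjacent_intervals
        ((hFc p).intervalIntegrable 0 (D.T - p.1)) ((hFc p).intervalIntegrable _ _),
      intervalIntegral.integral_congr (a := D.T - p.1) (g := fun _ => (0 : ℝ)) (fun s hs => ?_)]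
    · simp
    · rw [uIcc_of_le (by linarith [hpT.1])] at hs
      simp only [hF, hφT (p.1 + s) (by linarith [hs.1]), zero_mul, mul_zero]
  have hWint : ∀ p : ℝ × H, p.1 ∈ Icc 0 D.T →
      ∫ s in (0 : ℝ)..D.T, W s p = lam * O.opG lam (wave φ h θ) p - wave φ h θ p := by
    intro p hpT
    have hder : ∀ s ∈ Ioo 0 D.T, HasDerivAt (fun s => F s p) (W s p - lam * F s p) s := by
      intro s hs
      have h1 := hp.hasDerivAt_damp lam s
      have h2 := (hφ (p.1 + s)).comp_const_add p.1 s
      have h3 := ((hp.hasDerivAt_inner p.2 hs).add_const θ).cos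
      refine (h1.mul (h2.mul h3)).congr_deriv ?_
      simp only [hW, hF, waveV, Pi.mul_apply, ← hKdef, ← hLdef, ← hadef]
      ring
    have hci : Continuous fun s => W s p - lam * F s p := by
      have := hFc p; have := hWc p; fun_prop
    have h1 := intervalIntegral.integral_eq_sub_of_hasDerivAt_of_le D.hT.le
      (hFc p).continuousOn hder (hci.intervalIntegrable _ _)
    rw [intervalIntegral.integral_sub ((hWc p).intervalIntegrable _ _)
      (((hFc p).intervalIntegrable _ _).const_mul lam), intervalIntegral.integral_const_mul,
      hFint p hpT] at h1
    have h2 : F D.T p = 0 := by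
      simp only [hF, hφT (p.1 + D.T) (by linarith [hpT.1]), zero_mul, mul_zero]
    have h3 : F 0 p = wave φ h θ p := by
      simp only [hF, wave, hadef, damp_zero, add_zero, one_mul, hKdef]
      rw [D.inner_adjOrbit h p.2 ⟨le_rfl, D.hT.le⟩, D.S_zero]
      rfl
    rw [h2, h3] at h1
    linarith
  obtain ⟨N, hN⟩ := hFt.riemann_sum D.hT hFc (half_pos hε)
  obtain ⟨N', hN'⟩ := hWt.riemann_sum D.hT hWc (half_pos hε)
  set m := max N N' + 1 with hm
  have hm0 : (0 : ℝ) < m := by positivity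
  refine ⟨∑ i ∈ Finset.range m, (D.T / m) • F (i * (D.T / m)),
    ∑ i ∈ Finset.range m, (D.T / m) • W (i * (D.T / m)),
    IsOUPair.sum _ fun i hi => IsOUPair.smul ?_ _, fun p hpT => ?_⟩
  · set s := (i : ℝ) * (D.T / m) with hs
    have hs0 : 0 ≤ s := mul_nonneg (Nat.cast_nonneg _) (div_nonneg D.hT.le hm0.le)
    have hsT : s ≤ D.T := by
      rw [hs, mul_div_assoc', div_le_iff₀ hm0, mul_comm]
      refine mul_le_mul_of_nonneg_left ?_ D.hT.le
      exact_mod_cast (Finset.mem_range.1 hi).le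
    refine IsOUPair.smul (D.isOUPair_wave (φ := fun t => φ (t + s)) (φd := fun t => φd (t + s))
      (fun t => (hφ (t + s)).comp_add_const t s) (by fun_prop) (hφT _ (by linarith)) ?_ θ) (a s)
    rw [hKdef, hLdef, D.adjOrbit_of_mem h ⟨hs0, hsT⟩, D.adjOrbit_of_mem g ⟨hs0, hsT⟩]
    exact (hp.pair.adjoint_S hs0).mem_graph
  · have hw : ε / 2 * (1 + ‖p.2‖) ^ 2 ≤ ε * (1 + ‖p.2‖ ^ 2) := by
      nlinarith [one_add_sq_le ‖p.2‖]
    rw [← hWint p hpT, ← hFint p hpT]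
    simp only [Finset.sum_apply, Pi.smul_apply, smul_eq_mul]
    exact ⟨(hN m (by omega) p hpT).trans hw, (hN' m (by omega) p hpT).trans hw⟩

end FPData

namespace FPData

/-- A smooth cutoff, equal to `1` on `[T,∞)` and to `0` on `(-∞, T - δ]`. -/
noncomputable def endCutoff (T δ t : ℝ) : ℝ := Real.smoothTransition ((t - T + δ) / δ)

theorem contDiff_endCutoff (T δ : ℝ) : ContDiff ℝ 1 (endCutoff T δ) :=
  Real.smoothTransition.contDiff.comp
    (((contDiff_id.sub contDiff_const).add contDiff_const).div_const δ)

theorem endCutoff_nonneg (T δ t : ℝ) : 0 ≤ endCutoff T δ t := Real.smoothTransition.nonneg _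

theorem endCutoff_le_one (T δ t : ℝ) : endCutoff T δ t ≤ 1 := Real.smoothTransition.le_one _

theorem endCutoff_of_ge {T δ t : ℝ} (hδ : 0 < δ) (ht : T ≤ t) : endCutoff T δ t = 1 :=
  Real.smoothTransition.one_of_one_le (by rw [le_div_iff₀ hδ]; linarith)

theorem endCutoff_of_le {T δ t : ℝ} (hδ : 0 < δ) (ht : t ≤ T - δ) : endCutoff T δ t = 0 :=
  Real.smoothTransition.zero_of_nonpos (div_nonpos_of_nonpos_of_nonneg (by linarith) hδ.le)

theorem integral_endCutoff_le {T δ t : ℝ} (hδ : 0 < δ) (ht : t ≤ T) :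
    ∫ r in t..T, endCutoff T δ r ≤ δ := by
  have hc : Continuous (endCutoff T δ) := (contDiff_endCutoff T δ).continuous
  have hle : ∀ a ≤ T, ∫ r in a..T, endCutoff T δ r ≤ T - a := fun a ha => by
    have := intervalIntegral.integral_mono_on (μ := volume) ha (hc.intervalIntegrable a T)
      (intervalIntegrable_const (c := (1 : ℝ))) fun r _ => endCutoff_le_one T δ r
    simpa using this
  rcases le_total t (T - δ) with h | h
  · rw [← intervalIntegral.integral_add_adjacent_intervals (hc.intervalIntegrable t (T - δ))
      (hc.intervalIntegrable (T - δ) T),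
      intervalIntegral.integral_congr (a := t) (g := fun _ => (0 : ℝ)) fun r hr => ?_]
    · have := hle (T - δ) (by linarith)
      simp only [intervalIntegral.integral_zero, zero_add]
      linarith
    · rw [uIcc_of_le h] at hr
      exact endCutoff_of_le hδ hr.2
  · linarith [hle t ht]

theorem abs_integral_le_of_le_endCutoff {T δ t c : ℝ} (hδ : 0 < δ) (ht : t ≤ T) (hc : 0 ≤ c)
    {b : ℝ → ℝ} (hb : ∀ r ∈ Icc t T, |b r| ≤ c * endCutoff T δ r) :
    |∫ r in t..T, b r| ≤ c * δ := by
  have hcont : Continuous (endCutoff T δ) := (contDiff_endCutoff T δ).continuous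
  have h1 := intervalIntegral.norm_integral_le_of_norm_le (μ := volume) (f := b) ht
    (g := fun r => c * endCutoff T δ r)
    (Eventually.of_forall fun r hr => hb r (Ioc_subset_Icc_self hr))
    ((hcont.intervalIntegrable _ _).const_mul c)
  rw [intervalIntegral.integral_const_mul] at h1
  exact h1.trans (mul_le_mul_of_nonneg_left (integral_endCutoff_le hδ ht) hc)

variable {D : FPData H} {hyp : D.Hyp31} {h g : H}

theorem OUData.approximable_wave (O : D.OUData hyp) (lam : ℝ) (hp : D.IsRegularPair h g)
    {φ : ℝ → ℝ} (hφ : ContDiff ℝ 1 φ) (θ : ℝ) : O.Approximable lam (wave φ h θ) := by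
  refine ⟨O.admissible_wave lam hp hφ.continuous θ, fun ε hε => ?_⟩
  obtain ⟨Φ, hΦ⟩ := isCompact_Icc.exists_bound_of_continuousOn (s := Icc 0 D.T)
    hφ.continuous.continuousOn
  have hΦ0 : 0 ≤ Φ := (norm_nonneg _).trans (hΦ 0 ⟨le_rfl, D.hT.le⟩)
  obtain ⟨K, hK, hKb⟩ := O.exists_abs_kernelG_le lam
  have hK0 : 0 ≤ K := by linarith
  set c := |⟪D.C h, h⟫_ℝ| + ‖g‖ with hc
  have hc0 : 0 ≤ c := by positivity
  set B := Φ + Φ * K + Φ * c + |lam| * (Φ * K) + 1 with hB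
  have hB0 : 0 < B := by positivity
  set δ := ε / (2 * B) with hδdef
  have hδ : 0 < δ := by positivity
  have hδB : δ * B = ε / 2 := by rw [hδdef]; field_simp
  set φ₂ : ℝ → ℝ := fun t => φ t * endCutoff D.T δ t with hφ₂
  set φ₁ : ℝ → ℝ := fun t => φ t - φ₂ t with hφ₁
  have hφ₂d : ContDiff ℝ 1 φ₂ := hφ.mul (contDiff_endCutoff _ _)
  have hφ₁d : ContDiff ℝ 1 φ₁ := hφ.sub hφ₂d
  have hφ₂b : ∀ r ∈ Icc 0 D.T, |φ₂ r| ≤ Φ * endCutoff D.T δ r := fun r hr => by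
    rw [hφ₂, abs_mul, abs_of_nonneg (endCutoff_nonneg _ _ _)]
    exact mul_le_mul_of_nonneg_right (hΦ r hr) (endCutoff_nonneg _ _ _)
  have hsum : wave φ h θ = wave φ₁ h θ + wave φ₂ h θ := by
    funext p
    simp only [wave, hφ₁, Pi.add_apply]
    ring
  have h₁ : O.Approximable lam (wave φ₁ h θ) :=
    O.approximable_wave_of_vanishing lam hp
      (fun t => (hφ₁d.differentiable one_ne_zero t).hasDerivAt) (hφ₁d.continuous_deriv le_rfl)
      (fun t ht => by simp [hφ₁, hφ₂, endCutoff_of_ge hδ ht]) θ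
  have h₂ := O.admissible_wave lam hp hφ₂d.continuous θ
  obtain ⟨v, w, hv, hb⟩ := h₁.2 (ε / 2) (half_pos hε)
  set ψ : ℝ → ℝ := fun t => ∫ r in t..D.T, φ₂ r with hψ
  have hψd : ∀ t, HasDerivAt ψ (-φ₂ t) t := fun t =>
    intervalIntegral.integral_hasDerivAt_left (hφ₂d.continuous.intervalIntegrable _ _)
      (hφ₂d.continuous.stronglyMeasurableAtFilter _ _) hφ₂d.continuous.continuousAt
  have hψT : ψ D.T = 0 := intervalIntegral.integral_same
  refine ⟨v + wave ψ h θ, w + D.waveV ψ (fun t => -φ₂ t) h g θ,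
    hv.add (D.isOUPair_wave hψd hφ₂d.continuous.neg hψT hp.pair.mem_graph θ), fun p hpT => ?_⟩
  have hψb : |ψ p.1| ≤ Φ * δ := abs_integral_le_of_le_endCutoff hδ hpT.2 hΦ0 fun r hr =>
    hφ₂b r ⟨hpT.1.trans hr.1, hr.2⟩
  have hw1 : (1 : ℝ) ≤ 1 + ‖p.2‖ ^ 2 := by nlinarith [sq_nonneg ‖p.2‖]
  have hGb : |O.opG lam (wave φ₂ h θ) p| ≤ Φ * K * (1 + ‖p.2‖ ^ 2) * δ := by
    rw [O.opG_eq]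
    refine abs_integral_le_of_le_endCutoff hδ hpT.2 (by positivity) fun r hr => ?_
    have hr' : r ∈ Icc 0 D.T := ⟨hpT.1.trans hr.1, hr.2⟩
    refine (hKb _ (Φ * endCutoff D.T δ r) p hpT r (by rwa [uIcc_of_le hpT.2])
      fun y => ?_).trans_eq (by ring)
    rw [wave, abs_mul]
    have e1 := mul_le_of_le_one_right (abs_nonneg (φ₂ r))
      (Real.abs_cos_le_one (⟪y, h⟫_ℝ + θ))
    have e2 : 0 ≤ Φ * endCutoff D.T δ r := mul_nonneg hΦ0 (endCutoff_nonneg _ _ _)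
    have e3 := hφ₂b r hr'
    nlinarith [sq_nonneg ‖y‖]
  have hVb : |D.waveV ψ (fun t => -φ₂ t) h g θ p + wave φ₂ h θ p| ≤
      Φ * δ * (c * (1 + ‖p.2‖ ^ 2)) := by
    have e : D.waveV ψ (fun t => -φ₂ t) h g θ p + wave φ₂ h θ p =
        ψ p.1 * (-((1 / 2) * (⟪D.C h, h⟫_ℝ * Real.cos (⟪p.2, h⟫_ℝ + θ))) -
          ⟪p.2, g⟫_ℝ * Real.sin (⟪p.2, h⟫_ℝ + θ)) := by
      simp only [waveV, wave]; ring
    rw [e, abs_mul]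
    refine mul_le_mul hψb ?_ (abs_nonneg _) (by positivity)
    have e1 : |⟪D.C h, h⟫_ℝ * Real.cos (⟪p.2, h⟫_ℝ + θ)| ≤ |⟪D.C h, h⟫_ℝ| := by
      rw [abs_mul]
      exact mul_le_of_le_one_right (abs_nonneg _) (Real.abs_cos_le_one _)
    have e2 : |⟪p.2, g⟫_ℝ * Real.sin (⟪p.2, h⟫_ℝ + θ)| ≤ ‖p.2‖ * ‖g‖ := by
      rw [abs_mul]
      exact (mul_le_of_le_one_right (abs_nonneg _) (Real.abs_sin_le_one _)).trans
        (abs_real_inner_le_norm _ _)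
    have e3 : ‖p.2‖ ≤ 1 + ‖p.2‖ ^ 2 := by nlinarith [sq_nonneg (‖p.2‖ - 1)]
    have e4 := mul_le_mul_of_nonneg_right e3 (norm_nonneg g)
    have e5 := mul_le_mul_of_nonneg_left hw1 (abs_nonneg ⟪D.C h, h⟫_ℝ)
    rw [abs_le] at e1 e2 ⊢
    have e6 := abs_nonneg ⟪D.C h, h⟫_ℝ
    rw [hc]
    constructor <;> nlinarith
  obtain ⟨b1, b2⟩ := hb p hpT
  have hψw : |wave ψ h θ p| ≤ Φ * δ * (1 + ‖p.2‖ ^ 2) := by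
    rw [wave, abs_mul]
    have e1 := mul_le_of_le_one_right (abs_nonneg (ψ p.1))
      (Real.abs_cos_le_one (⟪p.2, h⟫_ℝ + θ))
    have : 0 ≤ Φ * δ := by positivity
    nlinarith
  have hW0 : 0 ≤ 1 + ‖p.2‖ ^ 2 := by linarith
  have key : (Φ + Φ * K) * δ * (1 + ‖p.2‖ ^ 2) ≤ ε / 2 * (1 + ‖p.2‖ ^ 2) := by
    refine mul_le_mul_of_nonneg_right ?_ hW0
    rw [← hδB, mul_comm]
    refine mul_le_mul_of_nonneg_left ?_ hδ.le
    have : 0 ≤ Φ * c + |lam| * (Φ * K) := by positivity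
    linarith
  have key' : (Φ * c + |lam| * (Φ * K)) * δ * (1 + ‖p.2‖ ^ 2) ≤
      ε / 2 * (1 + ‖p.2‖ ^ 2) := by
    refine mul_le_mul_of_nonneg_right ?_ hW0
    rw [← hδB, mul_comm]
    refine mul_le_mul_of_nonneg_left ?_ hδ.le
    have : 0 ≤ Φ + Φ * K := by positivity
    linarith
  rw [hsum, h₁.1.opG_add h₂ hpT]
  simp only [Pi.add_apply]
  have hlG : |lam * O.opG lam (wave φ₂ h θ) p| ≤ |lam| * (Φ * K * (1 + ‖p.2‖ ^ 2) * δ) := by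
    rw [abs_mul]
    exact mul_le_mul_of_nonneg_left hGb (abs_nonneg _)
  rw [abs_le] at b1 b2 hψw hGb hVb hlG
  constructor <;> rw [abs_le] <;> constructor <;> linarith

end FPData

namespace FPData

theorem exists_mem_subalgebra_near_of_abs_le {X : Type*} [TopologicalSpace X]
    {A : Subalgebra ℝ (X → ℝ)} (hcont : ∀ F ∈ A, Continuous F)
    (hsep : ∀ x y : X, x ≠ y → ∃ F ∈ A, F x ≠ F y) {S K : Set X}
    (hbdd : ∀ F ∈ A, ∃ B : ℝ, ∀ x ∈ S, |F x| ≤ B) (hK : IsCompact K) (hKS : K ⊆ S)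
    {g : X → ℝ} (hg : Continuous g) {M : ℝ} (hM : ∀ x ∈ K, |g x| ≤ M) (hM0 : 0 ≤ M)
    {ε : ℝ} (hε : 0 < ε) :
    ∃ F ∈ A, (∀ x ∈ S, |F x| ≤ M + ε) ∧ ∀ x ∈ K, |F x - g x| ≤ 2 * ε := by
  set A' : Subalgebra ℝ C(X, ℝ) := A.comap (ContinuousMap.coeFnAlgHom ℝ) with hA'
  have hsep' : A'.SeparatesPoints := fun x y hxy => by
    obtain ⟨F, hF, hne⟩ := hsep x y hxy
    exact ⟨F, ⟨⟨F, hcont F hF⟩, hF, rfl⟩, hne⟩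
  obtain ⟨G, hG, hGK⟩ :=
    ContinuousMap.exists_mem_subalgebra_near_continuous_of_isCompact_of_separatesPoints
      hsep' ⟨g, hg⟩ hK hε
  have hGA : (G : X → ℝ) ∈ A := hG
  obtain ⟨B, hB⟩ := hbdd _ hGA
  obtain ⟨q, hq⟩ := exists_polynomial_near_of_continuousOn (-B) B
    (fun s => max (-M) (min M s)) (by fun_prop) ε hε
  have hval : ∀ x, (Polynomial.aeval (G : X → ℝ) q) x = q.eval (G x) := fun x => by
    rw [Polynomial.aeval_fn_apply, Polynomial.coe_aeval_eq_eval]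
  refine ⟨Polynomial.aeval (G : X → ℝ) q,
    Algebra.adjoin_le (singleton_subset_iff.2 hGA)
      (Polynomial.aeval_mem_adjoin_singleton ℝ _), fun x hx => ?_, fun x hx => ?_⟩
  · rw [hval]
    have h1 := hq (G x) (abs_le.1 (hB x hx))
    have h2 : |max (-M) (min M (G x))| ≤ M :=
      abs_le.2 ⟨le_max_left _ _, max_le (by linarith) (min_le_left _ _)⟩
    have h3 := abs_sub_abs_le_abs_sub (q.eval (G x)) (max (-M) (min M (G x)))
    linarith
  · rw [hval]
    have h1 := hq (G x) (abs_le.1 (hB x (hKS hx)))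
    have h2 := hGK x hx
    have h3 := abs_le.1 (hM x hx)
    simp only [ContinuousMap.coe_mk, Real.norm_eq_abs] at h2
    have h4 : |max (-M) (min M (G x)) - g x| ≤ |G x - g x| := by
      conv_lhs => rw [← max_eq_right h3.1, ← min_eq_right h3.2]
      exact (abs_max_sub_max_le_max _ _ _ _).trans (max_le (by simp)
        ((abs_min_sub_min_le_max _ _ _ _).trans (max_le (by simp) le_rfl)))
    have h5 := abs_sub_le (q.eval (G x)) (max (-M) (min M (G x))) (g x)
    linarith

/-- The span of the plane waves `φ(t) cos(⟨x,h⟩ + θ)`. -/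
def waveSpan (H : Type) [NormedAddCommGroup H] [InnerProductSpace ℝ H] :
    Submodule ℝ (ℝ × H → ℝ) :=
  Submodule.span ℝ {F | ∃ (φ : ℝ → ℝ) (h : H) (θ : ℝ), ContDiff ℝ 1 φ ∧ F = wave φ h θ}

theorem wave_mem_waveSpan {φ : ℝ → ℝ} (hφ : ContDiff ℝ 1 φ) (h : H) (θ : ℝ) :
    wave φ h θ ∈ waveSpan H :=
  Submodule.subset_span ⟨φ, h, θ, hφ, rfl⟩

theorem wave_mul_wave (φ ψ : ℝ → ℝ) (h k : H) (θ τ : ℝ) :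
    wave φ h θ * wave ψ k τ =
      wave (fun t => φ t * ψ t / 2) (h + k) (θ + τ) +
        wave (fun t => φ t * ψ t / 2) (h - k) (θ - τ) := by
  funext p
  have h1 : ⟪p.2, h + k⟫_ℝ + (θ + τ) = (⟪p.2, h⟫_ℝ + θ) + (⟪p.2, k⟫_ℝ + τ) := by
    rw [inner_add_right]; ring
  have h2 : ⟪p.2, h - k⟫_ℝ + (θ - τ) = (⟪p.2, h⟫_ℝ + θ) - (⟪p.2, k⟫_ℝ + τ) := by
    rw [inner_sub_right]; ring
  simp only [wave, Pi.mul_apply, Pi.add_apply]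
  rw [h1, h2, Real.cos_add (⟪p.2, h⟫_ℝ + θ), Real.cos_sub (⟪p.2, h⟫_ℝ + θ)]
  ring

theorem mul_mem_waveSpan {F G : ℝ × H → ℝ} (hF : F ∈ waveSpan H) (hG : G ∈ waveSpan H) :
    F * G ∈ waveSpan H := by
  refine Submodule.span_induction₂ (p := fun x y _ _ => x * y ∈ waveSpan H) ?_
    (fun y _ => ?_) (fun x _ => ?_)
    (fun x y z _ _ _ h1 h2 => ?_) (fun x y z _ _ _ h1 h2 => ?_) (fun r x y _ _ h => ?_)
    (fun r x y _ _ h => ?_) hF hG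
  · rintro _ _ ⟨φ, h, θ, hφ, rfl⟩ ⟨ψ, k, τ, hψ, rfl⟩
    rw [wave_mul_wave]
    exact add_mem (wave_mem_waveSpan ((hφ.mul hψ).div_const 2) _ _)
      (wave_mem_waveSpan ((hφ.mul hψ).div_const 2) _ _)
  · rw [zero_mul]; exact zero_mem _
  · rw [mul_zero]; exact zero_mem _
  · rw [add_mul]; exact add_mem h1 h2
  · rw [mul_add]; exact add_mem h1 h2
  · rw [smul_mul_assoc]; exact Submodule.smul_mem _ _ h
  · rw [mul_smul_comm]; exact Submodule.smul_mem _ _ h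

theorem one_mem_waveSpan : (1 : ℝ × H → ℝ) ∈ waveSpan H := by
  have h : (1 : ℝ × H → ℝ) = wave (fun _ => 1) 0 0 := by
    funext p; simp [wave]
  rw [h]
  exact wave_mem_waveSpan contDiff_const _ _

/-- The algebra of trigonometric polynomials with `C¹` time-dependent coefficients. -/
def waveAlgebra (H : Type) [NormedAddCommGroup H] [InnerProductSpace ℝ H] [CompleteSpace H]
    [SecondCountableTopology H] [MeasurableSpace H] [BorelSpace H] :
    Subalgebra ℝ (ℝ × H → ℝ) :=
  (waveSpan H).toSubalgebra one_mem_waveSpan fun _ _ => mul_mem_waveSpan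

theorem mem_waveAlgebra {F : ℝ × H → ℝ} : F ∈ waveAlgebra H ↔ F ∈ waveSpan H := Iff.rfl

theorem continuous_of_mem_waveAlgebra {F : ℝ × H → ℝ} (hF : F ∈ waveAlgebra H) :
    Continuous F := by
  refine Submodule.span_induction ?_ continuous_const (fun _ _ _ _ h1 h2 => h1.add h2)
    (fun a _ _ h => h.const_smul a) (mem_waveAlgebra.1 hF)
  rintro _ ⟨φ, h, θ, hφ, rfl⟩
  have := hφ.continuous
  unfold wave
  fun_prop

theorem exists_bound_of_mem_waveAlgebra {F : ℝ × H → ℝ} (hF : F ∈ waveAlgebra H) (T : ℝ) :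
    ∃ B : ℝ, ∀ p ∈ Icc 0 T ×ˢ (univ : Set H), |F p| ≤ B := by
  refine Submodule.span_induction ?_ ⟨0, by simp⟩ ?_ ?_ (mem_waveAlgebra.1 hF)
  · rintro _ ⟨φ, h, θ, hφ, rfl⟩
    obtain ⟨B, hB⟩ := isCompact_Icc.exists_bound_of_continuousOn (s := Icc 0 T)
      hφ.continuous.continuousOn
    refine ⟨B, fun p hp => ?_⟩
    rw [wave, abs_mul]
    exact (mul_le_of_le_one_right (abs_nonneg _) (Real.abs_cos_le_one _)).trans (hB _ hp.1)
  · rintro F G - - ⟨B, hB⟩ ⟨B', hB'⟩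
    exact ⟨B + B', fun p hp => (abs_add_le _ _).trans (add_le_add (hB p hp) (hB' p hp))⟩
  · rintro a F - ⟨B, hB⟩
    refine ⟨|a| * B, fun p hp => ?_⟩
    rw [Pi.smul_apply, smul_eq_mul, abs_mul]
    exact mul_le_mul_of_nonneg_left (hB p hp) (abs_nonneg a)

theorem waveAlgebra_separates (p q : ℝ × H) (hpq : p ≠ q) :
    ∃ F ∈ waveAlgebra H, F p ≠ F q := by
  by_cases ht : p.1 = q.1
  · have hx : p.2 - q.2 ≠ 0 := sub_ne_zero.2 fun h => hpq (Prod.ext ht h)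
    have hn : (0 : ℝ) < ‖p.2 - q.2‖ ^ 2 := by positivity
    set k : H := (‖p.2 - q.2‖ ^ 2)⁻¹ • (p.2 - q.2) with hk
    refine ⟨wave (fun _ => 1) k (-⟪q.2, k⟫_ℝ),
      wave_mem_waveSpan contDiff_const _ _, ?_⟩
    have h1 : ⟪p.2, k⟫_ℝ + -⟪q.2, k⟫_ℝ = 1 := by
      rw [← sub_eq_add_neg, ← inner_sub_left, hk, real_inner_smul_right,
        real_inner_self_eq_norm_sq, inv_mul_cancel₀ hn.ne']
    simp only [wave, h1, add_neg_cancel, Real.cos_zero, one_mul]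
    have h2 := Real.cos_lt_cos_of_nonneg_of_le_pi le_rfl (by linarith [Real.two_le_pi]) one_pos
    exact h2.ne.trans_eq Real.cos_zero
  · exact ⟨wave (fun t => t) 0 0, wave_mem_waveSpan contDiff_id _ _, by simpa [wave] using ht⟩

variable {D : FPData H} {hyp : D.Hyp31}

theorem OUData.approximable_comp (O : D.OUData hyp) (lam : ℝ) {L : H →L[ℝ] H}
    (hL : ∀ y, ∃ g, D.IsRegularPair (ContinuousLinearMap.adjoint L y) g) {F : ℝ × H → ℝ}
    (hF : F ∈ waveAlgebra H) : O.Approximable lam fun p => F (p.1, L p.2) := by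
  refine Submodule.span_induction ?_ (O.approximable_zero lam) (fun _ _ _ _ h1 h2 => h1.add h2)
    (fun a _ _ h => h.smul a) (mem_waveAlgebra.1 hF)
  rintro _ ⟨φ, h, θ, hφ, rfl⟩
  obtain ⟨g, hg⟩ := hL h
  have := O.approximable_wave lam hg hφ θ
  simp only [wave, ← ContinuousLinearMap.adjoint_inner_right L] at this ⊢
  exact this

end FPData

namespace FPData

/-- The orthogonal projection onto the span of finitely many basis vectors. -/
noncomputable def truncate (D : FPData H) (s : Finset D.ι) : H →L[ℝ] H :=
  ∑ i ∈ s, (innerSL ℝ (D.basis i)).smulRight (D.basis i)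

theorem truncate_apply (D : FPData H) (s : Finset D.ι) (x : H) :
    D.truncate s x = ∑ i ∈ s, ⟪D.basis i, x⟫_ℝ • D.basis i := by
  simp [truncate]

theorem norm_sq_truncate (D : FPData H) (s : Finset D.ι) (x : H) :
    ‖D.truncate s x‖ ^ 2 = ∑ i ∈ s, ⟪D.basis i, x⟫_ℝ ^ 2 := by
  rw [← real_inner_self_eq_norm_sq, truncate_apply, D.basis.orthonormal.inner_sum]
  exact Finset.sum_congr rfl fun i _ => by simp [sq]

theorem sum_inner_sq_le (D : FPData H) (s : Finset D.ι) (x : H) :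
    ∑ i ∈ s, ⟪D.basis i, x⟫_ℝ ^ 2 ≤ ‖x‖ ^ 2 := by
  simpa using D.basis.orthonormal.sum_inner_products_le (s := s) x

theorem norm_truncate_le (D : FPData H) (s : Finset D.ι) (x : H) : ‖D.truncate s x‖ ≤ ‖x‖ :=
  le_of_sq_le_sq (by rw [norm_sq_truncate]; exact D.sum_inner_sq_le s x) (norm_nonneg x)

theorem inner_truncate (D : FPData H) {s : Finset D.ι} {i : D.ι} (hi : i ∈ s) (x : H) :
    ⟪D.basis i, D.truncate s x⟫_ℝ = ⟪D.basis i, x⟫_ℝ := by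
  rw [truncate_apply, D.basis.orthonormal.inner_right_sum _ hi]

theorem tendsto_truncate (D : FPData H) (x : H) :
    Tendsto (fun s => D.truncate s x) atTop (𝓝 x) := by
  have h := D.basis.hasSum_repr x
  simp only [HilbertBasis.repr_apply_apply] at h
  simpa only [truncate_apply, HasSum, SummationFilter.unconditional_filter] using h

/-- The compact set `[0,T] × {∑ cᵢ eᵢ : |cᵢ| ≤ R}`. -/
def box (D : FPData H) (s : Finset D.ι) (R : ℝ) : Set (ℝ × H) :=
  Icc 0 D.T ×ˢ ((fun c : D.ι → ℝ => ∑ i ∈ s, c i • D.basis i) ''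
    univ.pi fun _ => Icc (-R) R)

theorem isCompact_box (D : FPData H) (s : Finset D.ι) (R : ℝ) : IsCompact (D.box s R) :=
  isCompact_Icc.prod ((isCompact_univ_pi fun _ => isCompact_Icc).image (by fun_prop))

theorem mem_box (D : FPData H) (s : Finset D.ι) {R t : ℝ} {x : H} (ht : t ∈ Icc 0 D.T)
    (hx : ‖x‖ ≤ R) : (t, D.truncate s x) ∈ D.box s R := by
  refine ⟨ht, fun i => ⟪D.basis i, x⟫_ℝ, fun i _ => abs_le.1 ?_, (D.truncate_apply s x).symm⟩
  have h := abs_real_inner_le_norm (D.basis i) x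
  rw [D.basis.orthonormal.1 i, one_mul] at h
  exact h.trans hx

/-- A trigonometric polynomial approximating `1 + |x|²` on bounded subsets of a
finite-dimensional subspace. -/
noncomputable def weight (D : FPData H) (s : Finset D.ι) (N : ℝ) (p : ℝ × H) : ℝ :=
  1 + ∑ i ∈ s, 2 * N ^ 2 * (1 - Real.cos (⟪D.basis i, p.2⟫_ℝ / N))

theorem weight_mem (D : FPData H) (s : Finset D.ι) (N : ℝ) : D.weight s N ∈ waveAlgebra H := by
  have h : D.weight s N =
      1 + ∑ i ∈ s, (2 * N ^ 2) • (1 - wave (fun _ => 1) (N⁻¹ • D.basis i) 0) := by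
    funext p
    simp only [weight, Pi.add_apply, Pi.one_apply, Finset.sum_apply, Pi.smul_apply,
      Pi.sub_apply, smul_eq_mul, wave, real_inner_smul_right, add_zero, one_mul]
    congr 1
    refine Finset.sum_congr rfl fun i _ => ?_
    rw [real_inner_comm, div_eq_inv_mul]
  rw [h]
  exact add_mem (one_mem _) (sum_mem fun i _ => Subalgebra.smul_mem _
    (sub_mem (one_mem _) (wave_mem_waveSpan contDiff_const _ _)) _)

theorem one_le_weight (D : FPData H) (s : Finset D.ι) (N : ℝ) (p : ℝ × H) :
    1 ≤ D.weight s N p :=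
  le_add_of_nonneg_right (Finset.sum_nonneg fun _ _ =>
    mul_nonneg (by positivity) (sub_nonneg.2 (Real.cos_le_one _)))

theorem weight_le (D : FPData H) (s : Finset D.ι) {N : ℝ} (hN : 0 < N) (p : ℝ × H) :
    D.weight s N p ≤ 1 + ‖p.2‖ ^ 2 := by
  refine add_le_add_right ((Finset.sum_le_sum fun i _ => ?_).trans (D.sum_inner_sq_le s p.2)) 1
  exact two_mul_sq_mul_one_sub_cos_le hN

theorem le_weight (D : FPData H) (s : Finset D.ι) {N R : ℝ} (hN : 0 < N) (t : ℝ) {x : H}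
    (hx : ‖x‖ ≤ R) :
    1 + ‖D.truncate s x‖ ^ 2 - R ^ 4 / N ^ 2 ≤ D.weight s N (t, D.truncate s x) := by
  have hR : 0 ≤ R := (norm_nonneg x).trans hx
  have hx2 : ‖x‖ ^ 2 ≤ R ^ 2 := pow_le_pow_left₀ (norm_nonneg x) hx 2
  have hs := D.sum_inner_sq_le s x
  have hterm : ∀ i ∈ s, ⟪D.basis i, x⟫_ℝ ^ 2 * (1 - R ^ 2 / N ^ 2) ≤
      2 * N ^ 2 * (1 - Real.cos (⟪D.basis i, D.truncate s x⟫_ℝ / N)) := fun i hi => by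
    rw [D.inner_truncate hi]
    refine le_trans ?_ (le_two_mul_sq_mul_one_sub_cos hN)
    have h := abs_real_inner_le_norm (D.basis i) x
    rw [D.basis.orthonormal.1 i, one_mul] at h
    have h2 : ⟪D.basis i, x⟫_ℝ ^ 2 ≤ R ^ 2 := sq_le_sq' (by linarith [(abs_le.1 (h.trans hx)).1])
      (abs_le.1 (h.trans hx)).2
    gcongr
  have hsum := Finset.sum_le_sum hterm
  rw [← Finset.sum_mul, ← norm_sq_truncate] at hsum
  rw [← norm_sq_truncate] at hs
  have h4 : ‖D.truncate s x‖ ^ 2 * (R ^ 2 / N ^ 2) ≤ R ^ 4 / N ^ 2 := by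
    calc ‖D.truncate s x‖ ^ 2 * (R ^ 2 / N ^ 2) ≤ R ^ 2 * (R ^ 2 / N ^ 2) :=
          mul_le_mul_of_nonneg_right (hs.trans hx2) (by positivity)
      _ = R ^ 4 / N ^ 2 := by ring
  simp only [weight]
  linarith

theorem exists_regular_truncations (D : FPData H) :
    ∃ (L J : ℕ → H →L[ℝ] H) (s : ℕ → Finset D.ι) (M : ℝ), 1 ≤ M ∧
      (∀ n x, ‖J n x‖ ≤ M * ‖x‖) ∧ (∀ n x, L n x = D.truncate (s n) (J n x)) ∧
      (∀ x, Tendsto (fun n => L n x) atTop (𝓝 x)) ∧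
      ∀ n y, ∃ g, D.IsRegularPair (ContinuousLinearMap.adjoint (L n) y) g := by
  have := D.countable_basis
  obtain ⟨J, M, hM, hJ, hreg⟩ := D.exists_smoothing
  obtain ⟨s, hs⟩ := exists_seq_tendsto (atTop : Filter (Finset D.ι))
  refine ⟨fun n => (D.truncate (s n)).comp (J n), J, s, max 1 M, le_max_left _ _, fun n x => ?_,
    fun _ _ => rfl, fun x => ?_, fun n y => ?_⟩
  · exact (J n).le_of_opNorm_le ((hM n).trans (le_max_right _ _)) x
  · have h1 : Tendsto (fun n => D.truncate (s n) (J n x - x)) atTop (𝓝 0) :=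
      squeeze_zero_norm (fun n => D.norm_truncate_le _ _)
        (tendsto_iff_norm_sub_tendsto_zero.1 (hJ x))
    have h2 := h1.add ((D.tendsto_truncate x).comp hs)
    simpa [Function.comp_def, ← map_add] using h2
  · rw [ContinuousLinearMap.adjoint_comp]
    exact hreg n _

theorem MemCT.exists_bound {D : FPData H} {f : ℝ → H → ℝ} (hf : D.MemCT f) :
    ∃ M, 0 ≤ M ∧ ∀ t ∈ Icc 0 D.T, ∀ x, |f t x| ≤ M * (1 + ‖x‖ ^ 2) := by
  refine isCompact_Icc.induction_on (s := Icc 0 D.T)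
    (p := fun S => ∃ M : ℝ, 0 ≤ M ∧ ∀ t ∈ S, ∀ x, |f t x| ≤ M * (1 + ‖x‖ ^ 2))
    ⟨0, le_rfl, by simp⟩ (fun S S' h ⟨M, h0, hM⟩ => ⟨M, h0, fun t ht => hM t (h ht)⟩)
    (fun S S' ⟨M, h0, hM⟩ ⟨M', h0', hM'⟩ => ⟨M + M', by positivity, fun t ht x => ?_⟩)
    fun t₀ ht₀ => ?_
  · have hx : 0 ≤ 1 + ‖x‖ ^ 2 := by positivity
    rcases ht with ht | ht
    · exact (hM t ht x).trans (by nlinarith)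
    · exact (hM' t ht x).trans (by nlinarith)
  · obtain ⟨M, hM⟩ := (hf.1 t₀ ht₀).2
    obtain ⟨δ, hδ, h⟩ := hf.2 t₀ ht₀ 1 one_pos
    refine ⟨Icc 0 D.T ∩ Metric.ball t₀ δ, inter_mem_nhdsWithin _ (Metric.ball_mem_nhds _ hδ),
      1 + |M|, by positivity, fun t ht x => ?_⟩
    have h1 := h t ht.1 ht.2 x
    have h2 := hM x
    have h3 : M * (1 + ‖x‖ ^ 2) ≤ |M| * (1 + ‖x‖ ^ 2) :=
      mul_le_mul_of_nonneg_right (le_abs_self M) (by positivity)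
    have h4 := abs_sub_abs_le_abs_sub (f t x) (f t₀ x)
    linarith

theorem MemCT.exists_quotient {D : FPData H} {f : ℝ → H → ℝ} (hf : D.MemCT f) :
    ∃ g : ℝ × H → ℝ, Continuous g ∧
      ∀ p : ℝ × H, p.1 ∈ Icc 0 D.T → f p.1 p.2 = (1 + ‖p.2‖ ^ 2) * g p := by
  have hpos : ∀ x : H, (0 : ℝ) < 1 + ‖x‖ ^ 2 := fun x => by positivity
  set τ : ℝ → ℝ := fun t => projIcc 0 D.T D.hT.le t with hτ
  have hτm : ∀ t, τ t ∈ Icc 0 D.T := fun t => (projIcc 0 D.T D.hT.le t).2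
  have hτc : Continuous τ := continuous_subtype_val.comp continuous_projIcc
  refine ⟨fun p => f (τ p.1) p.2 / (1 + ‖p.2‖ ^ 2), ?_, fun p hp => ?_⟩
  · refine continuous_iff_continuousAt.2 fun q => Metric.tendsto_nhds.2 fun ε hε => ?_
    have h1 := ((hf.1 _ (hτm q.1)).1.continuous.comp continuous_snd).continuousAt (x := q)
    obtain ⟨δ, hδ, h2⟩ := hf.2 _ (hτm q.1) (ε / 2) (half_pos hε)
    have h3 := (hτc.comp continuous_fst).continuousAt (x := q)
    filter_upwards [Metric.tendsto_nhds.1 h1 (ε / 2) (half_pos hε),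
      Metric.tendsto_nhds.1 h3 δ hδ] with p hp1 hp2
    have h4 := h2 _ (hτm p.1) hp2 p.2
    refine (dist_triangle _ (f (τ q.1) p.2 / (1 + ‖p.2‖ ^ 2)) _).trans_lt ?_
    have h5 : dist (f (τ p.1) p.2 / (1 + ‖p.2‖ ^ 2)) (f (τ q.1) p.2 / (1 + ‖p.2‖ ^ 2)) ≤
        ε / 2 := by
      rw [Real.dist_eq, ← sub_div, abs_div, abs_of_pos (hpos _), div_le_iff₀ (hpos _)]
      exact h4
    have h6 : dist (f (τ q.1) p.2 / (1 + ‖p.2‖ ^ 2)) (f (τ q.1) q.2 / (1 + ‖q.2‖ ^ 2)) <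
        ε / 2 := hp1
    linarith
  · simp only [hτ, projIcc_of_mem D.hT.le hp]
    rw [mul_div_cancel₀ _ (hpos _).ne']

end FPData

namespace FPData

variable {D : FPData H} {hyp : D.Hyp31}

theorem OUData.exists_approximants (O : D.OUData hyp) (lam : ℝ) {f : ℝ → H → ℝ}
    (hf : D.MemCT f) :
    ∃ (F : ℕ → ℝ × H → ℝ) (c : ℝ), 0 ≤ c ∧ (∀ n, O.Approximable lam (F n)) ∧
      (∀ n, ∀ p : ℝ × H, p.1 ∈ Icc 0 D.T → |F n p| ≤ c * (1 + ‖p.2‖ ^ 2)) ∧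
      ∀ p : ℝ × H, p.1 ∈ Icc 0 D.T → Tendsto (fun n => F n p) atTop (𝓝 (f p.1 p.2)) := by
  obtain ⟨L, J, s, M, hM, hJ, hL, hLlim, hreg⟩ := D.exists_regular_truncations
  obtain ⟨Mf, hMf0, hMf⟩ := hf.exists_bound
  obtain ⟨g, hgc, hg⟩ := hf.exists_quotient
  have hpos : ∀ n : ℕ, (0 : ℝ) < (n : ℝ) + 1 := fun n => by positivity
  have hgM : ∀ p : ℝ × H, p.1 ∈ Icc 0 D.T → |g p| ≤ Mf := fun p hp => by
    have h := hMf p.1 hp p.2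
    have hx : 0 < 1 + ‖p.2‖ ^ 2 := by positivity
    rw [hg p hp, abs_mul, abs_of_pos hx, mul_comm] at h
    exact le_of_mul_le_mul_right h hx
  choose q hqA hqb hqK using fun n : ℕ =>
    exists_mem_subalgebra_near_of_abs_le (A := waveAlgebra H)
      (S := Icc 0 D.T ×ˢ (univ : Set H)) (fun F hF => continuous_of_mem_waveAlgebra hF)
      waveAlgebra_separates (fun F hF => exists_bound_of_mem_waveAlgebra hF D.T)
      (D.isCompact_box (s n) (n + 1)) (prod_mono le_rfl (subset_univ _)) hgc
      (fun p hp => hgM p hp.1) hMf0 (ε := 1 / ((n : ℝ) + 1)) (by have := hpos n; positivity)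
  set W : ℕ → ℝ × H → ℝ := fun n => D.weight (s n) (((n : ℝ) + 1) ^ 3) with hW
  have hLM : ∀ n x, ‖L n x‖ ≤ M * ‖x‖ := fun n x => by
    rw [hL]; exact (D.norm_truncate_le _ _).trans (hJ n x)
  refine ⟨fun n p => (W n * q n) (p.1, L n p.2), (Mf + 1) * M ^ 2, by positivity, fun n =>
    O.approximable_comp lam (hreg n) (mul_mem (D.weight_mem _ _) (hqA n)), fun n p hp => ?_,
    fun p hp => ?_⟩
  · have h1 : |q n (p.1, L n p.2)| ≤ Mf + 1 :=
      (hqb n (p.1, L n p.2) ⟨hp, mem_univ _⟩).trans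
        (add_le_add_right (by rw [div_le_one (hpos n)]; linarith [n.cast_nonneg (α := ℝ)]) _)
    have h2 : |W n (p.1, L n p.2)| ≤ M ^ 2 * (1 + ‖p.2‖ ^ 2) := by
      rw [abs_of_nonneg (zero_le_one.trans (D.one_le_weight _ _ _))]
      refine (D.weight_le (s n) (pow_pos (hpos n) 3) _).trans ?_
      have h3 := pow_le_pow_left₀ (norm_nonneg _) (hLM n p.2) 2
      simp only
      nlinarith
    simp only [Pi.mul_apply, abs_mul]
    calc _ ≤ M ^ 2 * (1 + ‖p.2‖ ^ 2) * (Mf + 1) :=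
          mul_le_mul h2 h1 (abs_nonneg _) (by positivity)
      _ = _ := by ring
  · have hy := hLlim p.2
    have hev : ∀ᶠ n : ℕ in atTop, ‖J n p.2‖ ≤ (n : ℝ) + 1 := by
      filter_upwards [tendsto_natCast_atTop_atTop.eventually_ge_atTop (M * ‖p.2‖)] with n hn
      linarith [hJ n p.2]
    have hinv : Tendsto (fun n : ℕ => 1 / ((n : ℝ) + 1)) atTop (𝓝 0) :=
      tendsto_one_div_add_atTop_nhds_zero_nat
    have hsq : Tendsto (fun n => 1 + ‖L n p.2‖ ^ 2) atTop (𝓝 (1 + ‖p.2‖ ^ 2)) :=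
      (hy.norm.pow 2).const_add 1
    have hWlim : Tendsto (fun n => W n (p.1, L n p.2)) atTop (𝓝 (1 + ‖p.2‖ ^ 2)) := by
      refine tendsto_of_tendsto_of_tendsto_of_le_of_le' ?_ hsq
        ?_ (Eventually.of_forall fun n => D.weight_le _ (pow_pos (hpos n) 3) _)
        (g := fun n => 1 + ‖L n p.2‖ ^ 2 - (1 / ((n : ℝ) + 1)) ^ 2)
      · simpa using hsq.sub (hinv.pow 2)
      filter_upwards [hev] with n hn
      have h := D.le_weight (s n) (N := ((n : ℝ) + 1) ^ 3) (pow_pos (hpos n) 3) p.1 hn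
      have h2 : ((n : ℝ) + 1) ^ 4 / (((n : ℝ) + 1) ^ 3) ^ 2 = (1 / ((n : ℝ) + 1)) ^ 2 := by
        have := (hpos n).ne'
        field_simp
      rw [h2, ← hL] at h
      exact h
    have hqlim : Tendsto (fun n => q n (p.1, L n p.2)) atTop (𝓝 (g p)) := by
      have h1 : Tendsto (fun n => g (p.1, L n p.2)) atTop (𝓝 (g (p.1, p.2))) :=
        (hgc.tendsto _).comp (tendsto_const_nhds.prodMk_nhds hy)
      have h2 : Tendsto (fun n => q n (p.1, L n p.2) - g (p.1, L n p.2)) atTop (𝓝 0) := by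
        refine squeeze_zero_norm' (a := fun n : ℕ => 2 * (1 / ((n : ℝ) + 1))) ?_
          (by simpa using hinv.const_mul 2)
        filter_upwards [hev] with n hn
        rw [hL]
        exact hqK n _ (D.mem_box (s n) hp hn)
      simpa using h2.add h1
    rw [hg p hp]
    exact hWlim.mul hqlim

theorem OUData.tendsto_Rop (O : D.OUData hyp) {F : ℕ → H → ℝ} {φ : H → ℝ} {c t : ℝ}
    (ht : t ∈ Icc 0 D.T) (hc : 0 ≤ c) (hF : ∀ n, Continuous (F n))
    (hb : ∀ n y, |F n y| ≤ c * (1 + ‖y‖ ^ 2))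
    (hlim : ∀ y, Tendsto (fun n => F n y) atTop (𝓝 (φ y))) (x : H) :
    Tendsto (fun n => O.Rop t (F n) x) atTop (𝓝 (O.Rop t φ x)) := by
  obtain ⟨K, -, hK⟩ := O.exists_Rop_bound
  obtain ⟨b, hbi, hbb, -⟩ := hK t ht x
  refine tendsto_integral_of_dominated_convergence (fun y => c * b y)
    (fun n => ((hF n).comp (by fun_prop)).aestronglyMeasurable) (hbi.const_mul c)
    (fun n => Eventually.of_forall fun y => ?_) (Eventually.of_forall fun y => hlim _)
  exact (hb n _).trans (mul_le_mul_of_nonneg_left (hbb y) hc)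

theorem OUData.tendsto_opG (O : D.OUData hyp) (lam : ℝ) {F : ℕ → ℝ × H → ℝ} {φ : ℝ × H → ℝ}
    {c : ℝ} (hc : 0 ≤ c) (hF : ∀ n, O.Admissible lam (F n))
    (hb : ∀ n, ∀ p : ℝ × H, p.1 ∈ Icc 0 D.T → |F n p| ≤ c * (1 + ‖p.2‖ ^ 2))
    (hlim : ∀ p : ℝ × H, p.1 ∈ Icc 0 D.T → Tendsto (fun n => F n p) atTop (𝓝 (φ p)))
    {p : ℝ × H} (hp : p.1 ∈ Icc 0 D.T) :
    Tendsto (fun n => O.opG lam (F n) p) atTop (𝓝 (O.opG lam φ p)) := by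
  obtain ⟨K, -, hK⟩ := O.exists_abs_kernelG_le lam
  simp only [opG_eq]
  refine intervalIntegral.tendsto_integral_filter_of_dominated_convergence
    (fun _ => c * K * (1 + ‖p.2‖ ^ 2))
    (Eventually.of_forall fun n => ((hF n).int p hp).aestronglyMeasurable_restrict_uIoc)
    (Eventually.of_forall fun n => Eventually.of_forall fun r hr => ?_) intervalIntegrable_const
    (Eventually.of_forall fun r hr => ?_)
  · have hr' := uIoc_subset_uIcc hr
    exact hK _ c p hp r hr' fun y => hb n (r, y) (sub_mem_horizon hp hr').1
  · obtain ⟨h1, h2⟩ := sub_mem_horizon hp (uIoc_subset_uIcc hr)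
    refine Tendsto.const_mul _ (O.tendsto_Rop h2 hc (fun n => ?_) (fun n y => hb n (r, y) h1)
      (fun y => hlim (r, y) h1) p.2)
    exact (hF n).cont.comp (by fun_prop)

theorem OUData.exists_abs_opG_le (O : D.OUData hyp) (lam : ℝ) :
    ∃ K, 0 ≤ K ∧ ∀ (f : ℝ × H → ℝ) (c : ℝ),
      (∀ p : ℝ × H, p.1 ∈ Icc 0 D.T → |f p| ≤ c * (1 + ‖p.2‖ ^ 2)) →
      ∀ p : ℝ × H, p.1 ∈ Icc 0 D.T → |O.opG lam f p| ≤ c * K * (1 + ‖p.2‖ ^ 2) := by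
  obtain ⟨K, hK1, hK⟩ := O.exists_abs_kernelG_le lam
  refine ⟨K * D.T, mul_nonneg (by linarith) D.hT.le, fun f c hf p hp => ?_⟩
  have hx : 0 < 1 + ‖p.2‖ ^ 2 := by positivity
  have hc : 0 ≤ c := nonneg_of_mul_nonneg_left ((abs_nonneg _).trans (hf p hp)) hx
  have h := intervalIntegral.norm_integral_le_of_norm_le_const (a := p.1) (b := D.T)
    (f := O.kernelG lam f p) (C := c * K * (1 + ‖p.2‖ ^ 2)) fun r hr =>
      hK f c p hp r (uIoc_subset_uIcc hr) fun y =>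
        hf (r, y) (sub_mem_horizon hp (uIoc_subset_uIcc hr)).1
  rw [opG_eq]
  refine h.trans ?_
  rw [abs_of_nonneg (by linarith [hp.2])]
  have h1 : c * K * (1 + ‖p.2‖ ^ 2) * (D.T - p.1) ≤ c * K * (1 + ‖p.2‖ ^ 2) * D.T :=
    mul_le_mul_of_nonneg_left (by linarith [hp.1]) (by positivity)
  linarith

end FPData

/-- Proposition 3.3: approximation of `u ∈ D(V)` by elements of `E_A`;
here `u = G_λ f`, so that `Vu = λu - f`. -/
theorem statement14 (D : FPData H) (hyp : D.Hyp31) (O : D.OUData hyp)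
    (ν : Measure (ℝ × H)) [IsFiniteMeasure ν]
    (hconc : ν {p : ℝ × H | p.1 ∉ Icc 0 D.T} = 0)
    (u : ℝ × H → ℝ) (lam : ℝ) (f : ℝ → H → ℝ) (hf : D.MemCT f)
    (hu : ∀ p : ℝ × H, u p = O.Gop lam f p) :
    ∃ (un : ℕ → ℝ × H → ℝ) (c₁ : ℝ), 0 < c₁ ∧ (∀ n, un n ∈ D.EA) ∧
      (∀ n, ∀ p : ℝ × H, p.1 ∈ Icc 0 D.T →
        |un n p| + |D.Vzero (un n) p| ≤ c₁ * (1 + ‖p.2‖ ^ 2)) ∧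
      TendstoInMeasure ν un atTop u ∧
      TendstoInMeasure ν (fun n => D.Vzero (un n)) atTop
        (fun p => lam * u p - f p.1 p.2) := by
  obtain ⟨F, c, hc, hF, hFb, hFlim⟩ := O.exists_approximants lam hf
  obtain ⟨K, hK0, hK⟩ := O.exists_abs_opG_le lam
  have hGlim : ∀ p : ℝ × H, p.1 ∈ Icc 0 D.T →
      Tendsto (fun n => O.opG lam (F n) p) atTop (𝓝 (u p)) := fun p hp => by
    rw [hu]
    exact O.tendsto_opG lam hc (fun n => (hF n).1) hFb (φ := fun p => f p.1 p.2) hFlim hp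
  choose v w hvw hest using fun n : ℕ => (hF n).2 (1 / ((n : ℝ) + 1)) (by positivity)
  have hV : ∀ n, D.Vzero (v n) = w n := fun n => (hvw n).Vzero_eq
  have hle : ∀ n : ℕ, 1 / ((n : ℝ) + 1) ≤ 1 := fun n => by
    rw [div_le_one (by positivity)]
    linarith [n.cast_nonneg (α := ℝ)]
  have hae : ∀ᵐ p ∂ν, p.1 ∈ Icc 0 D.T := hconc
  have hlim : ∀ {G a : ℕ → ℝ × H → ℝ} {l : ℝ × H → ℝ},
      (∀ n, Continuous (G n)) →
      (∀ n, ∀ p : ℝ × H, p.1 ∈ Icc 0 D.T →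
        |G n p - a n p| ≤ 1 / ((n : ℝ) + 1) * (1 + ‖p.2‖ ^ 2)) →
      (∀ p : ℝ × H, p.1 ∈ Icc 0 D.T → Tendsto (fun n => a n p) atTop (𝓝 (l p))) →
      TendstoInMeasure ν G atTop l := fun {G a l} hG hGa ha => by
    refine tendstoInMeasure_of_tendsto_ae (fun n => (hG n).aestronglyMeasurable) ?_
    filter_upwards [hae] with p hp
    have h0 : Tendsto (fun n : ℕ => 1 / ((n : ℝ) + 1) * (1 + ‖p.2‖ ^ 2)) atTop (𝓝 0) := by
      simpa using (tendsto_one_div_add_atTop_nhds_zero_nat (𝕜 := ℝ)).mul_const (1 + ‖p.2‖ ^ 2)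
    simpa using (squeeze_zero_norm (fun n => hGa n p hp) h0).add (ha p hp)
  refine ⟨v, c * K + (|lam| * (c * K) + c) + 2, by positivity, fun n => (hvw n).1,
    fun n p hp => ?_, hlim (fun n => (hvw n).2.1) (fun n p hp => (hest n p hp).1) hGlim, ?_⟩
  · have hx : 0 ≤ 1 + ‖p.2‖ ^ 2 := by positivity
    obtain ⟨h1, h2⟩ := hest n p hp
    have h3 := hK (F n) c (hFb n) p hp
    have h4 := hFb n p hp
    have h5 : |lam * O.opG lam (F n) p - F n p| ≤
        |lam| * (c * K * (1 + ‖p.2‖ ^ 2)) + c * (1 + ‖p.2‖ ^ 2) := by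
      refine (abs_sub _ _).trans (add_le_add ?_ h4)
      rw [abs_mul]
      exact mul_le_mul_of_nonneg_left h3 (abs_nonneg _)
    have h6 := abs_sub_abs_le_abs_sub (v n p) (O.opG lam (F n) p)
    have h7 := abs_sub_abs_le_abs_sub (w n p) (lam * O.opG lam (F n) p - F n p)
    have h8 := mul_le_mul_of_nonneg_right (hle n) hx
    rw [hV]
    linarith
  · simp only [hV]
    exact hlim (fun n => (hvw n).2.2.1) (fun n p hp => (hest n p hp).2) fun p hp =>
      ((hGlim p hp).const_mul lam).sub (hFlim p hp)

end Theorems
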